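/- Let d ≥ 2 and κ_i ≥ 0 (i = 1,…,d+1), let â be an admissible cutoff function, and let γ ≥ 2|κ| + 2. Then there exists a constant c_γ > 0, depending only on γ, κ and d, such that for all n ∈ ℕ, all 1 ≤ i < j ≤ d+1 and all x, y in the interior of △^d: |∂_{i,j} L_n^κ(x,y)| ≤ c_γ n^{d+1} ( √(x_i + x_j) + n^{−1} ) / ( √(x_i x_j) √(W_κ(n;x)) √(W_κ(n;y)) (1 + n d_△(x,y))^{γ − 2|κ| − 2} ), where the derivative ∂_{i,j} = ∂_i − ∂_j (with the convention ∂_{i,d+1} = ∂_i) acts in the x-variable and x_{d+1} = 1 − |x|. -/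

import Mathlib

open MeasureTheory Finset

noncomputable section

/-- The simplex `△^d = {x : x_i ≥ 0, x_1 + ⋯ + x_d ≤ 1}`. -/
def Splx (d : ℕ) : Set (Fin d → ℝ) := {x | (∀ i, 0 ≤ x i) ∧ ∑ i, x i ≤ 1}

/-- The `i`-th partial derivative. -/
def pd {d : ℕ} (i : Fin d) (f : (Fin d → ℝ) → ℝ) : (Fin d → ℝ) → ℝ :=
  fun x => fderiv ℝ f x (Pi.single i 1)

/-- `∂_{i,j} = ∂_i - ∂_j`. -/
def pdd {d : ℕ} (i j : Fin d) (f : (Fin d → ℝ) → ℝ) : (Fin d → ℝ) → ℝ :=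
  fun x => pd i f x - pd j f x

/-- `⟨x,∇⟩ = ∑ x_i ∂_i`. -/
def xgrad {d : ℕ} (f : (Fin d → ℝ) → ℝ) : (Fin d → ℝ) → ℝ :=
  fun x => ∑ i, x i * pd i f x

/-- The Jacobi weight `W_κ(x) = x_1^{κ_1} ⋯ x_d^{κ_d} (1-|x|)^{κ_{d+1}}`. -/
def Wk {d : ℕ} (κ : Fin (d+1) → ℝ) (x : Fin d → ℝ) : ℝ :=
  (∏ i : Fin d, x i ^ κ i.castSucc) * (1 - ∑ i, x i) ^ κ (Fin.last d)

/-- The spectral operator `D_κ`. -/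
def Dk {d : ℕ} (κ : Fin (d+1) → ℝ) (f : (Fin d → ℝ) → ℝ) (x : Fin d → ℝ) : ℝ :=
  (∑ i, x i * (1 - x i) * pd i (pd i f) x)
    - 2 * ∑ i, ∑ j ∈ Finset.univ.filter (fun j => i < j), x i * x j * pd i (pd j f) x
    + ∑ i, (κ i.castSucc + 1 - ((∑ k, κ k) + (d : ℝ) + 1) * x i) * pd i f x

/-- The normalizing constant `b_κ`. -/
def bk {d : ℕ} (κ : Fin (d+1) → ℝ) : ℝ :=
  Real.Gamma ((∑ i, κ i) + (d : ℝ) + 1) / ∏ i, Real.Gamma (κ i + 1)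

/-- The inner product `⟨f,g⟩_κ = b_κ ∫_{△^d} f g W_κ`. -/
def ipk {d : ℕ} (κ : Fin (d+1) → ℝ) (f g : (Fin d → ℝ) → ℝ) : ℝ :=
  bk κ * ∫ x in Splx d, f x * g x * Wk κ x

/-- The norm `‖f‖_{κ,2}`. -/
def nrm2 {d : ℕ} (κ : Fin (d+1) → ℝ) (f : (Fin d → ℝ) → ℝ) : ℝ :=
  Real.sqrt (ipk κ f f)

/-- Membership in `V_n^d(W_κ)`: a polynomial of degree (at most) `n` orthogonal to all
polynomials of lower degree. -/
def InVn (d n : ℕ) (κ : Fin (d+1) → ℝ) (f : MvPolynomial (Fin d) ℝ) : Prop :=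
  f.totalDegree ≤ n ∧ ∀ g : MvPolynomial (Fin d) ℝ, g.totalDegree < n →
    ipk κ (fun x => MvPolynomial.eval x f) (fun x => MvPolynomial.eval x g) = 0

/-- `x_k` for `1 ≤ k ≤ d+1`, with the convention `x_{d+1} = 1 - |x|`. -/
def xe {d : ℕ} (x : Fin d → ℝ) (k : Fin (d+1)) : ℝ :=
  if h : (k : ℕ) < d then x ⟨(k : ℕ), h⟩ else 1 - ∑ i, x i

/-- The distance `d_△(x,y) = arccos(Σ_{i=1}^{d+1} √(x_i) √(y_i))` on the simplex. -/
def dT {d : ℕ} (x y : Fin d → ℝ) : ℝ :=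
  Real.arccos ((∑ i, Real.sqrt (x i) * Real.sqrt (y i)) +
    Real.sqrt (1 - ∑ i, x i) * Real.sqrt (1 - ∑ i, y i))

/-- The ball `B(x,r)` of the metric `d_△` inside the simplex. -/
def ballT {d : ℕ} (x : Fin d → ℝ) (r : ℝ) : Set (Fin d → ℝ) :=
  {y ∈ Splx d | dT x y ≤ r}

/-- A doubling weight on the simplex: a nonnegative integrable function `w` such that
`w(B(x,2r)) ≤ c_w w(B(x,r))` uniformly in `x` and `r`. -/
def IsDoubling {d : ℕ} (w : (Fin d → ℝ) → ℝ) : Prop :=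
  (∀ x, 0 ≤ w x) ∧ MeasureTheory.IntegrableOn w (Splx d) ∧
    ∃ cw > 0, ∀ x ∈ Splx d, ∀ r : ℝ, 0 < r →
      (∫ y in ballT x (2 * r), w y) ≤ cw * ∫ y in ballT x r, w y

/-- `P` is the family of reproducing kernels of the spaces `V_j^d(W_κ)`:
`P j (·, y)` belongs to `V_j^d(W_κ)` for each fixed `y`, it is symmetric, and it
reproduces every element of `V_j^d(W_κ)`. -/
def IsRK (d : ℕ) (κ : Fin (d+1) → ℝ) (P : ℕ → (Fin d → ℝ) → (Fin d → ℝ) → ℝ) : Prop :=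
  ∀ j : ℕ,
    (∀ x y, P j x y = P j y x) ∧
    (∀ y, ∃ p : MvPolynomial (Fin d) ℝ, InVn d j κ p ∧ ∀ x, P j x y = MvPolynomial.eval x p) ∧
    (∀ p : MvPolynomial (Fin d) ℝ, InVn d j κ p → ∀ x,
      bk κ * ∫ y in Splx d, P j x y * MvPolynomial.eval y p * Wk κ y = MvPolynomial.eval x p)

/-- An admissible cutoff function: smooth, supported in `[0,2]` and equal to `1` on `[0,1]`. -/
def IsCutoff (a : ℝ → ℝ) : Prop :=
  ContDiff ℝ (⊤ : ℕ∞) a ∧ (∀ t, 2 < t → a t = 0) ∧ ∀ t, 0 ≤ t → t ≤ 1 → a t = 1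

/-- The localized kernel `L_n^κ(x,y) = Σ_{j=0}^∞ â(j/n) P_j^κ(x,y)`. -/
def Lk {d : ℕ} (a : ℝ → ℝ) (P : ℕ → (Fin d → ℝ) → (Fin d → ℝ) → ℝ) (n : ℕ)
    (x y : Fin d → ℝ) : ℝ :=
  ∑' j : ℕ, a ((j : ℝ) / (n : ℝ)) * P j x y

/-- `W_κ(n;x) = Π_{i=1}^{d+1} (x_i + n^{-2})^{κ_i + 1/2}` with `x_{d+1} = 1 - |x|`. -/
def Wkn {d : ℕ} (κ : Fin (d+1) → ℝ) (n : ℕ) (x : Fin d → ℝ) : ℝ :=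
  ∏ i : Fin (d+1), (xe x i + 1 / (n : ℝ) ^ 2) ^ (κ i + 1/2)

/-- The partial derivative `∂_k` for `1 ≤ k ≤ d+1`, with the convention `∂_{d+1} = 0`
(so that `∂_{i,j} = pdE i - pdE j` realizes the convention `∂_{i,d+1} = ∂_i`). -/
def pdE {d : ℕ} (k : Fin (d+1)) (f : (Fin d → ℝ) → ℝ) (x : Fin d → ℝ) : ℝ :=
  if h : (k : ℕ) < d then pd ⟨(k : ℕ), h⟩ f x else 0

open scoped Nat

/-- The rising factorial `c (c+1) ⋯ (c+n-1)`. -/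
def rf (c : ℝ) (n : ℕ) : ℝ := ∏ i ∈ range n, (c + i)

lemma rf_zero (c : ℝ) : rf c 0 = 1 := by simp [rf]

lemma rf_succ (c : ℝ) (n : ℕ) : rf c (n + 1) = rf c n * (c + n) := by
  simp [rf, prod_range_succ]

lemma rf_add (c : ℝ) (m n : ℕ) : rf c (m + n) = rf c m * rf (c + m) n := by
  simp only [rf, prod_range_add]
  congr 1
  refine prod_congr rfl fun i _ => ?_
  push_cast; ring

lemma rf_succ' (c : ℝ) (n : ℕ) : rf c (n + 1) = c * rf (c + 1) n := by
  rw [add_comm, rf_add]; simp [rf]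

lemma rf_pos {c : ℝ} (hc : 0 < c) (n : ℕ) : 0 < rf c n :=
  prod_pos fun i _ => by positivity

/-- The coefficient of `u ^ l` in the Gegenbauer polynomial of degree `k` and index `μ`. -/
def gegCoeff (μ : ℝ) (k l : ℕ) : ℝ :=
  if l ≤ k ∧ 2 ∣ (k - l) then
    (-1) ^ ((k - l) / 2) * rf μ (l + (k - l) / 2) * 2 ^ l / (((k - l) / 2)! * l !)
  else 0

lemma gegCoeff_add (μ : ℝ) (l j : ℕ) :
    gegCoeff μ (l + 2 * j) l = (-1) ^ j * rf μ (l + j) * 2 ^ l / (j ! * l !) := by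
  simp [gegCoeff]

lemma gegCoeff_eq_zero (μ : ℝ) {k l : ℕ} (h : ∀ j, k ≠ l + 2 * j) : gegCoeff μ k l = 0 := by
  rw [gegCoeff, if_neg]
  rintro ⟨h1, j, hj⟩
  exact h j (by omega)

/-- The Gegenbauer polynomial of degree `k` and index `μ`. -/
def geg (μ : ℝ) (k : ℕ) : Polynomial ℝ :=
  ∑ l ∈ range (k + 1), Polynomial.C (gegCoeff μ k l) * Polynomial.X ^ l

lemma coeff_geg (μ : ℝ) (k l : ℕ) : (geg μ k).coeff l = gegCoeff μ k l := by
  simp only [geg, Polynomial.finsetSum_coeff, Polynomial.coeff_C_mul_X_pow]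
  rw [Finset.sum_ite_eq]
  split_ifs with h
  · rfl
  · exact (gegCoeff_eq_zero μ fun j => by simp at h; omega).symm

lemma geg_zero (μ : ℝ) : geg μ 0 = 1 := by
  simp [geg, gegCoeff, rf]

lemma geg_one (μ : ℝ) : geg μ 1 = Polynomial.C (2 * μ) * Polynomial.X := by
  simp [geg, gegCoeff, rf, Finset.sum_range_succ]
  ring

lemma gegCoeff_rec_zero (μ : ℝ) (k : ℕ) :
    (k + 2) * gegCoeff μ (k + 2) 0 = - ((k + 2 * μ) * gegCoeff μ k 0) := by
  by_cases h : ∃ j, k = 0 + 2 * j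
  · obtain ⟨j, rfl⟩ := h
    rw [gegCoeff_add, show 0 + 2 * j + 2 = 0 + 2 * (j + 1) by ring, gegCoeff_add,
      ← add_assoc, rf_succ, Nat.factorial_succ]
    have : (j ! : ℝ) ≠ 0 := by positivity
    push_cast
    field_simp
    ring
  · push Not at h
    rw [gegCoeff_eq_zero μ h, gegCoeff_eq_zero μ (fun j => ?_)]
    · simp
    · rcases j with _ | j
      · omega
      · have := h j; omega

lemma gegCoeff_rec_succ (μ : ℝ) (k l : ℕ) :
    (k + 2) * gegCoeff μ (k + 2) (l + 1) =
      2 * (k + 1 + μ) * gegCoeff μ (k + 1) l - (k + 2 * μ) * gegCoeff μ k (l + 1) := by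
  by_cases h : ∃ j, k + 1 = l + 2 * j
  · obtain ⟨j, hj⟩ := h
    rcases j with _ | j
    · obtain rfl : l = k + 1 := by omega
      rw [gegCoeff_eq_zero μ (k := k) (fun j => by omega)]
      have h1 := gegCoeff_add μ (k + 1) 0
      have h2 := gegCoeff_add μ (k + 1 + 1) 0
      simp only [mul_zero, add_zero, pow_zero, one_mul, Nat.factorial_zero, Nat.cast_one] at h1 h2
      rw [h1, h2, rf_succ, Nat.factorial_succ (k + 1)]
      have : ((k + 1) ! : ℝ) ≠ 0 := by positivity
      push_cast
      field_simp
      ring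
    · obtain rfl : k = l + 1 + 2 * j := by omega
      rw [gegCoeff_add, show l + 1 + 2 * j + 2 = l + 1 + 2 * (j + 1) by ring, gegCoeff_add,
        show l + 1 + 2 * j + 1 = l + 2 * (j + 1) by ring, gegCoeff_add, show l + 1 + (j + 1) =
        l + j + 1 + 1 by ring, show l + 1 + j = l + j + 1 by ring, ← add_assoc,
        rf_succ μ (l + j + 1),
        Nat.factorial_succ, Nat.factorial_succ]
      have : (j ! : ℝ) ≠ 0 := by positivity
      have : (l ! : ℝ) ≠ 0 := by positivity
      push_cast
      field_simp
      ring
  · push Not at h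
    rw [gegCoeff_eq_zero μ h, gegCoeff_eq_zero μ (fun j => ?_), gegCoeff_eq_zero μ (fun j => ?_)]
    · simp
    · have := h (j + 1); omega
    · have := h j; omega

lemma geg_rec (μ : ℝ) (k : ℕ) :
    Polynomial.C ((k : ℝ) + 2) * geg μ (k + 2) =
      Polynomial.C (2 * (k + 1 + μ)) * (geg μ (k + 1) * Polynomial.X)
        - Polynomial.C (k + 2 * μ) * geg μ k := by
  ext l
  rcases l with _ | l
  · simp only [Polynomial.coeff_C_mul, Polynomial.coeff_sub, coeff_geg,
      Polynomial.coeff_mul_X_zero, gegCoeff_rec_zero]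
    ring
  · simp only [Polynomial.coeff_C_mul, Polynomial.coeff_sub, coeff_geg,
      Polynomial.coeff_mul_X, gegCoeff_rec_succ]

lemma eval_geg_rec (μ u : ℝ) (k : ℕ) :
    (k + 2) * (geg μ (k + 2)).eval u =
      2 * (k + 1 + μ) * u * (geg μ (k + 1)).eval u - (k + 2 * μ) * (geg μ k).eval u := by
  have := congrArg (Polynomial.eval u) (geg_rec μ k)
  simp only [Polynomial.eval_mul, Polynomial.eval_sub, Polynomial.eval_C, Polynomial.eval_X] at this
  rw [this]; ring

lemma derivative_geg_zero (μ : ℝ) : Polynomial.derivative (geg μ 0) = 0 := by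
  simp [geg_zero]

lemma derivative_geg_succ (μ : ℝ) (k : ℕ) :
    Polynomial.derivative (geg μ (k + 1)) = Polynomial.C (2 * μ) * geg (μ + 1) k := by
  ext l
  rw [Polynomial.coeff_derivative, Polynomial.coeff_C_mul, coeff_geg, coeff_geg]
  by_cases h : ∃ j, k = l + 2 * j
  · obtain ⟨j, rfl⟩ := h
    rw [gegCoeff_add, show l + 2 * j + 1 = l + 1 + 2 * j by ring, gegCoeff_add,
      show l + 1 + j = l + j + 1 by ring, rf_succ', Nat.factorial_succ]
    have : (j ! : ℝ) ≠ 0 := by positivity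
    have : (l ! : ℝ) ≠ 0 := by positivity
    push_cast
    field_simp
    ring
  · push Not at h
    rw [gegCoeff_eq_zero _ h, gegCoeff_eq_zero _ (fun j => by have := h j; omega)]
    simp

/-- The binomial series of `(1 - z X) ^ (-μ)`. -/
def binSeries (μ : ℝ) (z : ℂ) : PowerSeries ℂ :=
  PowerSeries.mk fun n => ((rf μ n / n ! : ℝ) : ℂ) * z ^ n

lemma binSeries_ode (μ : ℝ) (z : ℂ) :
    PowerSeries.derivative ℂ (binSeries μ z)
      - PowerSeries.C z * (PowerSeries.X * PowerSeries.derivative ℂ (binSeries μ z)) =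
      PowerSeries.C (μ * z) * binSeries μ z := by
  ext n
  rcases n with _ | n
  · rw [map_sub, PowerSeries.coeff_derivative, PowerSeries.coeff_C_mul,
      PowerSeries.coeff_zero_X_mul, PowerSeries.coeff_C_mul]
    simp [binSeries, rf]
  · simp only [map_sub, PowerSeries.coeff_derivative, PowerSeries.coeff_C_mul,
      PowerSeries.coeff_succ_X_mul, binSeries, PowerSeries.coeff_mk, rf_succ, Nat.factorial_succ]
    have : (n ! : ℂ) ≠ 0 := by exact_mod_cast Nat.factorial_ne_zero n
    have h2 : (n : ℂ) + 1 ≠ 0 := by exact_mod_cast Nat.succ_ne_zero n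
    have h3 : (n : ℂ) + 1 + 1 ≠ 0 := by exact_mod_cast Nat.succ_ne_zero (n + 1)
    push_cast
    field_simp
    ring

lemma eval_geg_eq_coeff (μ u : ℝ) (z w : ℂ) (hzw : z * w = 1) (hu : z + w = 2 * u) (k : ℕ) :
    (((geg μ k).eval u : ℝ) : ℂ) =
      PowerSeries.coeff k (binSeries μ z * binSeries μ w) := by
  set h := binSeries μ z * binSeries μ w with hh
  have ode : PowerSeries.derivative ℂ h
      - PowerSeries.C (2 * (u : ℂ)) * (PowerSeries.X * PowerSeries.derivative ℂ h)
      + PowerSeries.X * (PowerSeries.X * PowerSeries.derivative ℂ h)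
      = PowerSeries.C (2 * μ * u : ℂ) * h - PowerSeries.C (2 * μ : ℂ) * (PowerSeries.X * h) := by
    have hz := binSeries_ode μ z
    have hw := binSeries_ode μ w
    have e1 : (PowerSeries.C (2 * (u : ℂ)) : PowerSeries ℂ) = PowerSeries.C z + PowerSeries.C w := by
      rw [← hu, map_add]
    have e2 : (PowerSeries.C z : PowerSeries ℂ) * PowerSeries.C w = 1 := by
      rw [← map_mul, hzw, map_one]
    have e3 : (PowerSeries.C (2 * μ * u : ℂ) : PowerSeries ℂ)
        = PowerSeries.C (μ : ℂ) * (PowerSeries.C z + PowerSeries.C w) := by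
      rw [← e1, ← map_mul]; congr 1; ring
    have e4 : (PowerSeries.C (2 * μ : ℂ) : PowerSeries ℂ) = 2 * PowerSeries.C (μ : ℂ) := by
      rw [map_mul]; rfl
    rw [map_mul] at hz hw
    have hd : PowerSeries.derivative ℂ h = binSeries μ z * PowerSeries.derivative ℂ (binSeries μ w)
        + binSeries μ w * PowerSeries.derivative ℂ (binSeries μ z) := by
      rw [hh, Derivation.leibniz]; simp
    rw [e1, e3, e4, hd, hh]
    set A := binSeries μ z
    set B := binSeries μ w
    set A' := PowerSeries.derivative ℂ A
    set B' := PowerSeries.derivative ℂ B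
    set Z : PowerSeries ℂ := PowerSeries.C z
    set W : PowerSeries ℂ := PowerSeries.C w
    set M : PowerSeries ℂ := PowerSeries.C (μ : ℂ)
    set X : PowerSeries ℂ := PowerSeries.X
    linear_combination (1 - W * X) * B * hz + (1 - Z * X) * A * hw
      + (-X ^ 2 * (A * B' + B * A') - 2 * M * X * A * B) * e2
  have recur : ∀ n : ℕ, ((n : ℂ) + 2) * PowerSeries.coeff (n + 2) h =
      2 * (n + 1 + μ) * u * PowerSeries.coeff (n + 1) h
        - (n + 2 * μ) * PowerSeries.coeff n h := by
    intro n
    have := congrArg (PowerSeries.coeff (n + 1)) ode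
    rcases n with _ | n
    · simp only [map_sub, map_add, PowerSeries.coeff_derivative, PowerSeries.coeff_C_mul,
        PowerSeries.coeff_succ_X_mul, PowerSeries.coeff_zero_X_mul] at this
      push_cast at this ⊢
      linear_combination this
    · simp only [map_sub, map_add, PowerSeries.coeff_derivative, PowerSeries.coeff_C_mul,
        PowerSeries.coeff_succ_X_mul] at this
      push_cast at this ⊢
      linear_combination this
  have h0 : PowerSeries.coeff 0 h = 1 := by
    rw [hh, PowerSeries.coeff_mul]
    simp [binSeries, rf]
  have h1 : PowerSeries.coeff 1 h = 2 * μ * u := by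
    rw [hh, PowerSeries.coeff_mul, Finset.Nat.antidiagonal_succ]
    simp [binSeries, rf]
    linear_combination (μ : ℂ) * hu
  induction k using Nat.strong_induction_on with
  | _ k ih =>
    rcases k with _ | _ | k
    · simp [h0, geg_zero]
    · simp [h1, geg_one]
    · have hk : ((k : ℂ) + 2) ≠ 0 := by exact_mod_cast Nat.succ_ne_zero (k + 1)
      apply mul_left_cancel₀ hk
      rw [recur k, ← ih k (by omega), ← ih (k + 1) (by omega)]
      exact_mod_cast eval_geg_rec μ u k

lemma rf_div_factorial_le {μ : ℝ} (hμ : 2 ≤ μ) (n : ℕ) :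
    rf μ n / n ! ≤ ((n : ℝ) + 1) ^ (μ - 1) := by
  induction n with
  | zero => simp [rf]
  | succ n ih =>
    have hn : (0 : ℝ) < n + 1 := by positivity
    have e : rf μ (n + 1) / (n + 1)! = rf μ n / n ! * (1 + (μ - 1) * (1 / (n + 1))) := by
      rw [rf_succ, Nat.factorial_succ]
      have : (n ! : ℝ) ≠ 0 := by positivity
      push_cast
      field_simp
      ring
    have hb : 1 + (μ - 1) * (1 / ((n : ℝ) + 1)) ≤ (1 + 1 / ((n : ℝ) + 1)) ^ (μ - 1) :=
      one_add_mul_self_le_rpow_one_add (by have : 0 ≤ 1 / ((n : ℝ) + 1) := by positivity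
                                           linarith) (by linarith)
    have e2 : ((n + 1 : ℕ) : ℝ) + 1 = ((n : ℝ) + 1) * (1 + 1 / (n + 1)) := by
      push_cast; field_simp
    rw [e, e2, Real.mul_rpow hn.le (by positivity)]
    have : 0 ≤ (μ - 1) * (1 / ((n : ℝ) + 1)) := by
      apply mul_nonneg (by linarith) (by positivity)
    gcongr

lemma abs_eval_geg_le {μ : ℝ} (hμ : 2 ≤ μ) {u : ℝ} (hu : |u| ≤ 1) (k : ℕ) :
    |(geg μ k).eval u| ≤ ((k : ℝ) + 1) ^ (2 * μ - 1) := by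
  obtain ⟨hu1, hu2⟩ := abs_le.mp hu
  set z : ℂ := Complex.exp (Real.arccos u * Complex.I)
  set w : ℂ := Complex.exp (-(Real.arccos u * Complex.I))
  have hz : ‖z‖ = 1 := Complex.norm_exp_ofReal_mul_I _
  have hw : ‖w‖ = 1 := by
    have := Complex.norm_exp_ofReal_mul_I (-Real.arccos u)
    simpa [w] using this
  have hzw : z * w = 1 := by rw [← Complex.exp_add]; simp
  have hsum : z + w = 2 * (u : ℂ) := by
    have : Complex.cos (Real.arccos u : ℂ) = (u : ℂ) := by
      rw [← Complex.ofReal_cos, Real.cos_arccos hu1 hu2]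
    rw [← this, Complex.cos]
    simp only [z, w, neg_mul]
    ring
  have h := eval_geg_eq_coeff μ u z w hzw hsum k
  have h2 : |(geg μ k).eval u| = ‖(((geg μ k).eval u : ℝ) : ℂ)‖ := by simp
  rw [h2, h, PowerSeries.coeff_mul]
  have hk : (0 : ℝ) < k + 1 := by positivity
  have hb : ∀ n : ℕ, n ≤ k → rf μ n / n ! ≤ ((k : ℝ) + 1) ^ (μ - 1) := fun n hn =>
    (rf_div_factorial_le hμ n).trans (Real.rpow_le_rpow (by positivity)
      (by exact_mod_cast Nat.succ_le_succ hn) (by linarith))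
  have hb0 : ∀ n : ℕ, 0 ≤ rf μ n / n ! := fun n =>
    div_nonneg (rf_pos (by linarith) n).le (by positivity)
  calc _ ≤ ∑ p ∈ antidiagonal k, ((k : ℝ) + 1) ^ (μ - 1) * ((k : ℝ) + 1) ^ (μ - 1) := by
        refine (norm_sum_le _ _).trans (sum_le_sum fun p hp => ?_)
        have hp' := mem_antidiagonal.mp hp
        simp only [binSeries, PowerSeries.coeff_mk, norm_mul, norm_pow, hz, hw, one_pow, mul_one,
          Complex.norm_real, Real.norm_eq_abs, abs_of_nonneg (hb0 _)]
        exact mul_le_mul (hb _ (by omega)) (hb _ (by omega)) (hb0 _) (by positivity)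
    _ = ((k : ℝ) + 1) ^ (2 * μ - 1) := by
        rw [sum_const, Nat.card_antidiagonal, nsmul_eq_mul, ← Real.rpow_add hk,
          show 2 * μ - 1 = 1 + (μ - 1 + (μ - 1)) by ring, Real.rpow_add hk 1, Real.rpow_one]
        push_cast; ring

/-- The second order difference operator which represents multiplication by `1 - u` on the
coefficients of a Gegenbauer expansion. -/
def recOp (μ : ℝ) (α : ℤ → ℝ) (k : ℤ) : ℝ :=
  -(1 / 2) * ((α (k + 1) - 2 * α k + α (k - 1)) + μ * (1 / (k + μ)) * (α (k + 1) - α (k - 1)))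

lemma one_sub_mul_sum_geg {μ : ℝ} (hμ : 0 < μ) (u : ℝ) (α : ℤ → ℝ) (M : ℕ) :
    (1 - u) * ∑ k ∈ range (M + 1), α k * ((k + μ) * (geg μ k).eval u) =
      ∑ k ∈ range (M + 1), recOp μ α k * ((k + μ) * (geg μ k).eval u)
        - 1 / 2 * ((M + 1) * α M * (geg μ (M + 1)).eval u
          - (M + 2 * μ) * α (M + 1) * (geg μ M).eval u) := by
  induction M with
  | zero =>
    simp [recOp, geg_zero, geg_one]
    field_simp
    ring
  | succ M ih =>
    rw [sum_range_succ, mul_add, ih, sum_range_succ (n := M + 1)]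
    have h := eval_geg_rec μ u M
    have hk : (M : ℝ) + 1 + μ ≠ 0 := by positivity
    have e : recOp μ α ((M + 1 : ℕ) : ℤ) * ((((M + 1 : ℕ) : ℝ) + μ) * (geg μ (M + 1)).eval u) =
        -(1 / 2) * (((M : ℝ) + 1 + μ) * (α (M + 2) - 2 * α (M + 1) + α M)
          + μ * (α (M + 2) - α M)) * (geg μ (M + 1)).eval u := by
      simp only [recOp]
      rw [show (((M + 1 : ℕ) : ℤ) + 1) = M + 2 by push_cast; ring,
        show (((M + 1 : ℕ) : ℤ) - 1) = M by push_cast; ring]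
      push_cast
      field_simp
    rw [e]
    push_cast
    rw [show ((M : ℤ) + 1 + 1) = M + 2 by ring]
    linear_combination (1 / 2 * α (M + 1)) * h

/-- The forward difference of a family of sequences. -/
def fdiff (f : ℕ → ℤ → ℝ) (n : ℕ) (k : ℤ) : ℝ := f n (k + 1) - f n k

/-- The members of the family are of size `n ^ (-s)` and supported in `k ≥ n - O(1)`. -/
def DecayBound (s : ℕ) (f : ℕ → ℤ → ℝ) : Prop :=
  ∃ C : ℕ, ∀ n : ℕ, C ≤ n → 0 < n → ∀ k : ℤ, |f n k| ≤ C / (n : ℝ) ^ s ∧ (k + C < n → f n k = 0)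

/-- Each of the first `j` differences gains a further factor `n⁻¹`. -/
def SymbolClass : ℕ → ℕ → (ℕ → ℤ → ℝ) → Prop
  | 0, s, f => DecayBound s f
  | j + 1, s, f => DecayBound s f ∧ SymbolClass j (s + 1) (fdiff f)

lemma DecayBound.add {s : ℕ} {f g : ℕ → ℤ → ℝ} (hf : DecayBound s f) (hg : DecayBound s g) :
    DecayBound s (fun n k => f n k + g n k) := by
  obtain ⟨C, hC⟩ := hf
  obtain ⟨D, hD⟩ := hg
  refine ⟨C + D, fun n hn hn0 k => ⟨?_, fun hk => ?_⟩⟩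
  · have h1 := (hC n (by omega) hn0 k).1
    have h2 := (hD n (by omega) hn0 k).1
    push_cast
    rw [add_div]
    exact (abs_add_le _ _).trans (add_le_add h1 h2)
  · push_cast at hk
    simp only [(hC n (by omega) hn0 k).2 (by omega), (hD n (by omega) hn0 k).2 (by omega), add_zero]

lemma DecayBound.const_mul {s : ℕ} {f : ℕ → ℤ → ℝ} (hf : DecayBound s f) (c : ℝ) :
    DecayBound s (fun n k => c * f n k) := by
  obtain ⟨C, hC⟩ := hf
  refine ⟨(⌈|c|⌉₊ + 1) * C, fun n hn hn0 k => ⟨?_, fun hk => ?_⟩⟩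
  · have h1 := (hC n (by nlinarith) hn0 k).1
    have h2 := Nat.le_ceil |c|
    rw [abs_mul]
    push_cast
    rw [mul_div_assoc]
    exact mul_le_mul (by linarith) h1 (abs_nonneg _) (by positivity)
  · have h3 : (k : ℤ) + C < n := by
      push_cast at hk
      nlinarith [Int.natCast_nonneg C, Int.natCast_nonneg ⌈|c|⌉₊,
        mul_nonneg (Int.natCast_nonneg ⌈|c|⌉₊) (Int.natCast_nonneg C)]
    simp only [(hC n (by nlinarith) hn0 k).2 h3, mul_zero]

lemma DecayBound.shift {s : ℕ} {f : ℕ → ℤ → ℝ} (hf : DecayBound s f) (c : ℤ) :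
    DecayBound s (fun n k => f n (k + c)) := by
  obtain ⟨C, hC⟩ := hf
  refine ⟨C + c.natAbs, fun n hn hn0 k => ⟨?_, fun hk => ?_⟩⟩
  · refine ((hC n (by omega) hn0 (k + c)).1).trans ?_
    push_cast
    gcongr
    simp
  · exact (hC n (by omega) hn0 (k + c)).2 (by
      push_cast [Int.natCast_natAbs] at hk
      have := le_abs_self c
      omega)

lemma DecayBound.congr {s : ℕ} {f g : ℕ → ℤ → ℝ} (hf : DecayBound s f) (N : ℕ)
    (h : ∀ n, N ≤ n → 0 < n → ∀ k, f n k = g n k) : DecayBound s g := by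
  obtain ⟨C, hC⟩ := hf
  refine ⟨C + N, fun n hn hn0 k => ⟨?_, fun hk => ?_⟩⟩
  · rw [← h n (by omega) hn0 k]
    refine ((hC n (by omega) hn0 k).1).trans ?_
    push_cast
    gcongr
    simp
  · rw [← h n (by omega) hn0 k]
    exact (hC n (by omega) hn0 k).2 (by push_cast at hk; omega)

lemma DecayBound.weight_mul {μ : ℝ} (hμ : 0 < μ) {s : ℕ} {f : ℕ → ℤ → ℝ} (hf : DecayBound s f) :
    DecayBound (s + 1) (fun n k => 1 / ((k : ℝ) + μ) * f n k) := by
  obtain ⟨C, hC⟩ := hf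
  refine ⟨2 * C, fun n hn hn0 k => ⟨?_, fun hk => ?_⟩⟩
  · by_cases hk : k + C < n
    · simp only [(hC n (by omega) hn0 k).2 hk, mul_zero, abs_zero]
      positivity
    · have h1 := (hC n (by omega) hn0 k).1
      have hn' : (0 : ℝ) < n := by exact_mod_cast hn0
      have h2 : (n : ℝ) / 2 ≤ k + μ := by
        have : (n : ℤ) ≤ 2 * k := by omega
        have : (n : ℝ) ≤ 2 * k := by exact_mod_cast this
        linarith
      have h3 : |1 / ((k : ℝ) + μ)| ≤ 2 / n := by
        rw [abs_of_nonneg (by apply one_div_nonneg.mpr; linarith)]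
        rw [div_le_div_iff₀ (by linarith) hn']
        linarith
      rw [abs_mul]
      calc _ ≤ 2 / (n : ℝ) * (C / (n : ℝ) ^ s) := mul_le_mul h3 h1 (abs_nonneg _) (by positivity)
        _ = _ := by push_cast; field_simp; ring
  · simp only [(hC n (by omega) hn0 k).2 (by push_cast at hk; omega), mul_zero]

lemma SymbolClass.decayBound {j s : ℕ} {f : ℕ → ℤ → ℝ} (hf : SymbolClass j s f) :
    DecayBound s f := by
  cases j with
  | zero => exact hf
  | succ j => exact hf.1

lemma SymbolClass.of_succ {j s : ℕ} {f : ℕ → ℤ → ℝ} (hf : SymbolClass (j + 1) s f) :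
    SymbolClass j s f := by
  induction j generalizing s f with
  | zero => exact hf.1
  | succ j ih => exact ⟨hf.1, ih hf.2⟩

lemma SymbolClass.add {j s : ℕ} {f g : ℕ → ℤ → ℝ} (hf : SymbolClass j s f)
    (hg : SymbolClass j s g) : SymbolClass j s (fun n k => f n k + g n k) := by
  induction j generalizing s f g with
  | zero => exact DecayBound.add hf hg
  | succ j ih =>
    refine ⟨DecayBound.add hf.1 hg.1, ?_⟩
    convert ih hf.2 hg.2 using 1
    ext n k; simp only [fdiff]; ring

lemma SymbolClass.const_mul {j s : ℕ} {f : ℕ → ℤ → ℝ} (hf : SymbolClass j s f) (c : ℝ) :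
    SymbolClass j s (fun n k => c * f n k) := by
  induction j generalizing s f with
  | zero => exact DecayBound.const_mul hf c
  | succ j ih =>
    refine ⟨DecayBound.const_mul hf.1 c, ?_⟩
    convert ih hf.2 using 1
    ext n k; simp only [fdiff]; ring

lemma SymbolClass.shift {j s : ℕ} {f : ℕ → ℤ → ℝ} (hf : SymbolClass j s f) (c : ℤ) :
    SymbolClass j s (fun n k => f n (k + c)) := by
  induction j generalizing s f with
  | zero => exact DecayBound.shift hf c
  | succ j ih =>
    refine ⟨DecayBound.shift hf.1 c, ?_⟩
    convert ih hf.2 using 1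
    ext n k; simp only [fdiff]; rw [show k + 1 + c = k + c + 1 by ring]

lemma SymbolClass.congr {j s : ℕ} {f g : ℕ → ℤ → ℝ} (hf : SymbolClass j s f) (N : ℕ)
    (h : ∀ n, N ≤ n → 0 < n → ∀ k, f n k = g n k) : SymbolClass j s g := by
  induction j generalizing s f g with
  | zero => exact DecayBound.congr hf N h
  | succ j ih =>
    refine ⟨DecayBound.congr hf.1 N h, ih hf.2 fun n hn hn0 k => ?_⟩
    simp only [fdiff, h n hn hn0]

lemma SymbolClass.weight_mul {μ : ℝ} (hμ : 0 < μ) {j s : ℕ} {f : ℕ → ℤ → ℝ}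
    (hf : SymbolClass j s f) : SymbolClass j (s + 1) (fun n k => 1 / ((k : ℝ) + μ) * f n k) := by
  induction j generalizing s f with
  | zero => exact DecayBound.weight_mul hμ hf
  | succ j ih =>
    refine ⟨DecayBound.weight_mul hμ hf.1, ?_⟩
    have h1 := hf.2.add (((ih hf.of_succ).shift 1).const_mul (-1))
    have h2 := ih h1
    obtain ⟨C, hC⟩ := hf.1
    refine h2.congr (C + 1) fun n hn hn0 k => ?_
    simp only [fdiff]
    by_cases hk : 0 ≤ k
    · have : (0 : ℝ) ≤ k := by exact_mod_cast hk
      have h3 : (k : ℝ) + μ ≠ 0 := by positivity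
      have h4 : (k : ℝ) + 1 + μ ≠ 0 := by positivity
      push_cast
      field_simp
      ring
    · rw [(hC n (by omega) hn0 k).2 (by omega), (hC n (by omega) hn0 (k + 1)).2 (by omega)]
      ring

lemma SymbolClass.recOp {μ : ℝ} (hμ : 0 < μ) {s : ℕ} {f : ℕ → ℤ → ℝ}
    (hf : ∀ j, SymbolClass j (s + 1) (fdiff f)) (j : ℕ) :
    SymbolClass j (s + 2) (fun n => recOp μ (f n)) := by
  have h1 := (hf (j + 1)).2.shift (-1)
  have h2 := (((hf j).add ((hf j).shift (-1))).weight_mul hμ).const_mul μ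
  refine ((h1.add h2).const_mul (-(1 / 2))).congr 0 fun n _ _ k => ?_
  simp only [fdiff, _root_.recOp]
  rw [show k + -1 + 1 = k by ring, show k + -1 = k - 1 by ring]
  ring

lemma SymbolClass.recOp_iterate {μ : ℝ} (hμ : 0 < μ) {f : ℕ → ℤ → ℝ}
    (hf : ∀ j, SymbolClass j 1 (fdiff f)) (m j : ℕ) :
    SymbolClass j (2 * (m + 1)) (fun n => (_root_.recOp μ)^[m + 1] (f n)) := by
  induction m generalizing j with
  | zero => simpa using SymbolClass.recOp hμ hf j
  | succ m ih =>
    have := SymbolClass.recOp hμ (fun j => (ih (j + 1)).2) j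
    rw [show 2 * (m + 1 + 1) = 2 * (m + 1) + 2 by ring]
    simp only [Function.iterate_succ_apply' _ (m + 1)]
    exact this

lemma SymbolClass.of_iterate {s : ℕ} {f : ℕ → ℤ → ℝ}
    (hf : ∀ i, DecayBound (s + i) (fdiff^[i] f)) (j : ℕ) : SymbolClass j s f := by
  induction j generalizing s f with
  | zero => exact hf 0
  | succ j ih =>
    refine ⟨hf 0, ih fun i => ?_⟩
    have := hf (i + 1)
    rwa [Function.iterate_succ_apply, ← add_assoc, add_right_comm] at this

lemma abs_fwdDiff_iter_le {g : ℝ → ℝ} (hg : ContDiff ℝ (⊤ : ℕ∞) g) (i : ℕ) {M : ℝ}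
    (hM : ∀ t, |iteratedDeriv i g t| ≤ M) {h : ℝ} (hh : 0 < h) (t : ℝ) :
    |((fwdDiff h)^[i] g) t| ≤ M * h ^ i := by
  induction i generalizing g M with
  | zero => simpa using hM t
  | succ i ih =>
    rw [Function.iterate_succ_apply]
    have hs : ContDiff ℝ (⊤ : ℕ∞) (fun x => g (x + h)) := hg.comp (contDiff_id.add contDiff_const)
    have hd : ContDiff ℝ (⊤ : ℕ∞) (fwdDiff h g) := hs.sub hg
    have hdiff : Differentiable ℝ (iteratedDeriv i g) :=
      hg.differentiable_iteratedDeriv i (by exact_mod_cast WithTop.coe_lt_top i)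
    have := ih hd (M := M * h) (fun t => ?_)
    · rw [pow_succ]; linarith
    · have e : iteratedDeriv i (fwdDiff h g) t =
          iteratedDeriv i g (t + h) - iteratedDeriv i g t := by
        have e1 : fwdDiff h g = (fun x => g (x + h)) - g := rfl
        rw [e1, iteratedDeriv_sub
          (hs.contDiffAt.of_le (by exact_mod_cast le_top))
          (hg.contDiffAt.of_le (by exact_mod_cast le_top)),
          iteratedDeriv_comp_add_const]
      rw [e]
      have := Convex.norm_image_sub_le_of_norm_deriv_le (f := iteratedDeriv i g) (C := M)
        (s := Set.univ) (x := t) (y := t + h) (fun x _ => hdiff x)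
        (fun x _ => by rw [← iteratedDeriv_succ]; exact hM x) convex_univ trivial trivial
      simpa [abs_of_pos hh] using this

/-- The cutoff function, extended by the constant `1` to the negative half line. -/
def extCutoff (a : ℝ → ℝ) (t : ℝ) : ℝ := if 0 ≤ t then a t else 1

lemma extCutoff_of_nonneg (a : ℝ → ℝ) {t : ℝ} (ht : 0 ≤ t) : extCutoff a t = a t := if_pos ht

lemma extCutoff_of_le_one {a : ℝ → ℝ} (ha : IsCutoff a) {t : ℝ} (ht : t ≤ 1) :
    extCutoff a t = 1 := by
  unfold extCutoff
  split_ifs with h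
  · exact ha.2.2 t h ht
  · rfl

lemma extCutoff_of_two_lt {a : ℝ → ℝ} (ha : IsCutoff a) {t : ℝ} (ht : 2 < t) :
    extCutoff a t = 0 := by
  rw [extCutoff_of_nonneg a (by linarith), ha.2.1 t ht]

lemma contDiff_extCutoff {a : ℝ → ℝ} (ha : IsCutoff a) :
    ContDiff ℝ (⊤ : ℕ∞) (extCutoff a) := by
  rw [contDiff_iff_contDiffAt]
  intro t
  rcases lt_or_ge 0 t with ht | ht
  · refine ha.1.contDiffAt.congr_of_eventuallyEq ?_
    filter_upwards [lt_mem_nhds ht] with s hs using extCutoff_of_nonneg a hs.le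
  · refine (contDiffAt_const (c := (1 : ℝ))).congr_of_eventuallyEq ?_
    filter_upwards [gt_mem_nhds (lt_of_le_of_lt ht one_pos)] with s hs
      using extCutoff_of_le_one ha hs.le

lemma exists_abs_iteratedDeriv_extCutoff_le {a : ℝ → ℝ} (ha : IsCutoff a) (i : ℕ) :
    ∃ M, ∀ t, |iteratedDeriv (i + 1) (extCutoff a) t| ≤ M := by
  have hc : HasCompactSupport (deriv (extCutoff a)) := by
    refine HasCompactSupport.intro (isCompact_Icc (a := (0 : ℝ)) (b := 2)) fun t ht => ?_
    rw [Set.mem_Icc, not_and_or, not_le, not_le] at ht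
    rcases ht with ht | ht
    · have : extCutoff a =ᶠ[nhds t] fun _ => 1 := by
        filter_upwards [gt_mem_nhds (ht.trans one_pos)] with s hs
          using extCutoff_of_le_one ha hs.le
      rw [this.deriv_eq, deriv_const]
    · have : extCutoff a =ᶠ[nhds t] fun _ => 0 := by
        filter_upwards [lt_mem_nhds ht] with s hs using extCutoff_of_two_lt ha hs
      rw [this.deriv_eq, deriv_const]
  have hs : HasCompactSupport (iteratedDeriv (i + 1) (extCutoff a)) := by
    rw [iteratedDeriv_succ']
    generalize deriv (extCutoff a) = f at hc
    induction i with
    | zero => simpa using hc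
    | succ i ih => rw [iteratedDeriv_succ]; exact ih.deriv
  have hcont : Continuous (iteratedDeriv (i + 1) (extCutoff a)) :=
    (contDiff_extCutoff ha).continuous_iteratedDeriv _ (by exact_mod_cast le_top)
  obtain ⟨M, hM⟩ := hcont.bounded_above_of_compact_support hs
  exact ⟨M, fun t => by simpa using hM t⟩

/-- The samples of the cutoff function which occur in the localized kernel. -/
def cutSamples (a : ℝ → ℝ) (n : ℕ) (k : ℤ) : ℝ := extCutoff a ((k + 1) / (2 * n))

lemma fdiff_iterate_cutSamples (a : ℝ → ℝ) (i : ℕ) (n : ℕ) (k : ℤ) :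
    fdiff^[i] (cutSamples a) n k
      = (fwdDiff (1 / (2 * (n : ℝ))))^[i] (extCutoff a) ((k + 1) / (2 * n)) := by
  induction i generalizing k with
  | zero => rfl
  | succ i ih =>
    rw [Function.iterate_succ_apply', Function.iterate_succ_apply', fdiff, ih, ih, fwdDiff,
      ← add_div]
    push_cast
    rfl

lemma symbolClass_fdiff_cutSamples {a : ℝ → ℝ} (ha : IsCutoff a) (j : ℕ) :
    SymbolClass j 1 (fdiff (cutSamples a)) := by
  refine SymbolClass.of_iterate (fun i => ?_) j
  obtain ⟨M, hM⟩ := exists_abs_iteratedDeriv_extCutoff_le ha i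
  have hM0 : 0 ≤ M := (abs_nonneg _).trans (hM 0)
  refine ⟨⌈M⌉₊ + i + 2, fun n hn hn0 k => ?_⟩
  have hn' : (0 : ℝ) < n := by exact_mod_cast hn0
  rw [← Function.iterate_succ_apply, fdiff_iterate_cutSamples]
  constructor
  · refine (abs_fwdDiff_iter_le (contDiff_extCutoff ha) (i + 1) hM (by positivity) _).trans ?_
    rw [div_pow, one_pow, mul_pow, add_comm 1 i, mul_one_div]
    have h2 : (1 : ℝ) ≤ 2 ^ (i + 1) := one_le_pow₀ (by norm_num)
    gcongr
    · push_cast; have := Nat.le_ceil M; have : (0 : ℝ) ≤ i := i.cast_nonneg; linarith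
    · nlinarith [pow_pos hn' (i + 1)]
  · intro hk
    rw [fwdDiff_iter_eq_sum_shift]
    have : ∀ l ∈ range (i + 1 + 1),
        extCutoff a (((k : ℝ) + 1) / (2 * n) + l • (1 / (2 * (n : ℝ)))) = 1 := by
      intro l hl
      refine extCutoff_of_le_one ha ?_
      rw [nsmul_eq_mul, mul_one_div, ← add_div, div_le_one (by positivity)]
      have hl' : l ≤ i + 1 := by have := mem_range.mp hl; omega
      have h3 : k + 1 + l ≤ 2 * n := by push_cast at hk; omega
      exact_mod_cast h3
    rw [sum_congr rfl fun l hl => by rw [this l hl]]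
    have h4 := Int.alternating_sum_range_choose_of_ne (n := i + 1) (by omega)
    have h5 : (∑ l ∈ range (i + 1 + 1), (-1 : ℤ) ^ (i + 1 - l) * ((i + 1).choose l : ℤ)) = 0 := by
      rw [← sum_range_reflect]
      rw [← h4]
      refine sum_congr rfl fun l hl => ?_
      have hl' : l ≤ i + 1 := by have := mem_range.mp hl; omega
      rw [show i + 1 + 1 - 1 - l = i + 1 - l by omega, Nat.choose_symm hl',
        show i + 1 - (i + 1 - l) = l by omega]
    simp only [zsmul_eq_mul, mul_one]
    rw [← Int.cast_sum, h5, Int.cast_zero]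

/-- The Gegenbauer sum whose coefficients arise from the samples of the cutoff function by
`m` applications of the recurrence operator. -/
def gegSum (μ : ℝ) (a : ℝ → ℝ) (m n : ℕ) (u : ℝ) : ℝ :=
  ∑ k ∈ range (4 * n + m), (recOp μ)^[m] (cutSamples a n) k * ((k + μ) * (geg μ k).eval u)

lemma cutSamples_eq_zero {a : ℝ → ℝ} (ha : IsCutoff a) {n : ℕ} (hn : 0 < n) {k : ℤ}
    (hk : 4 * n ≤ k) : cutSamples a n k = 0 := by
  refine extCutoff_of_two_lt ha ?_
  have hn' : (0 : ℝ) < n := by exact_mod_cast hn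
  rw [lt_div_iff₀ (by positivity)]
  have : (4 * n : ℝ) ≤ k := by exact_mod_cast hk
  linarith

lemma recOp_iterate_cutSamples_eq_zero {a : ℝ → ℝ} (ha : IsCutoff a) (μ : ℝ) {n : ℕ} (hn : 0 < n)
    (m : ℕ) {k : ℤ} (hk : 4 * n + m ≤ k) : (recOp μ)^[m] (cutSamples a n) k = 0 := by
  induction m generalizing k with
  | zero => exact cutSamples_eq_zero ha hn (by push_cast at hk; omega)
  | succ m ih =>
    rw [Function.iterate_succ_apply']
    push_cast at hk
    rw [recOp, ih (by omega), ih (by omega), ih (by omega)]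
    ring

lemma one_sub_mul_gegSum {a : ℝ → ℝ} (ha : IsCutoff a) {μ : ℝ} (hμ : 0 < μ) {n : ℕ} (hn : 0 < n)
    (m : ℕ) (u : ℝ) : (1 - u) * gegSum μ a m n u = gegSum μ a (m + 1) n u := by
  have h := one_sub_mul_sum_geg hμ u ((recOp μ)^[m] (cutSamples a n)) (4 * n + m)
  rw [recOp_iterate_cutSamples_eq_zero ha μ hn m (k := ((4 * n + m : ℕ) : ℤ)) (by push_cast; omega),
    recOp_iterate_cutSamples_eq_zero ha μ hn m (k := ((4 * n + m : ℕ) : ℤ) + 1)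
      (by push_cast; omega), sum_range_succ,
    recOp_iterate_cutSamples_eq_zero ha μ hn m (k := ((4 * n + m : ℕ) : ℤ))
      (by push_cast; omega)] at h
  simp only [zero_mul, add_zero, mul_zero, sub_zero] at h
  rw [gegSum, h, gegSum]
  refine sum_congr rfl fun k _ => ?_
  rw [Function.iterate_succ_apply']

lemma pow_mul_gegSum {a : ℝ → ℝ} (ha : IsCutoff a) {μ : ℝ} (hμ : 0 < μ) {n : ℕ} (hn : 0 < n)
    (m : ℕ) (u : ℝ) : (1 - u) ^ m * gegSum μ a 0 n u = gegSum μ a m n u := by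
  induction m with
  | zero => simp
  | succ m ih => rw [← one_sub_mul_gegSum ha hμ hn, ← ih]; ring

lemma abs_gegSum_le {μ : ℝ} (hμ : 2 ≤ μ) (a : ℝ → ℝ) (m : ℕ) {n : ℕ} (hn : 0 < n) {B : ℝ}
    (hB : ∀ k, |(recOp μ)^[m] (cutSamples a n) k| ≤ B) {u : ℝ} (hu : |u| ≤ 1) :
    |gegSum μ a m n u| ≤ ((4 + m) * (4 + m + μ) ^ (2 * μ)) * B * (n : ℝ) ^ (2 * μ + 1) := by
  have hn' : (1 : ℝ) ≤ n := by exact_mod_cast hn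
  have hm : (0 : ℝ) ≤ m := m.cast_nonneg
  have hB0 : 0 ≤ B := (abs_nonneg _).trans (hB 0)
  have key : ∀ k ∈ range (4 * n + m), |(recOp μ)^[m] (cutSamples a n) k *
      ((k + μ) * (geg μ k).eval u)| ≤ B * ((4 + m + μ) * n) ^ (2 * μ) := by
    intro k hk
    have hk' : (k : ℝ) ≤ 4 * n + m := by exact_mod_cast (mem_range.mp hk).le
    have hk0 : (0 : ℝ) ≤ k := k.cast_nonneg
    have e : (k : ℝ) + μ ≤ (4 + m + μ) * n := by nlinarith
    rw [abs_mul, abs_mul, abs_of_nonneg (by linarith : (0 : ℝ) ≤ k + μ)]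
    refine mul_le_mul (hB k) ?_ (by positivity) hB0
    calc (k + μ) * |(geg μ k).eval u| ≤ ((4 + m + μ) * n) * ((4 + m + μ) * n) ^ (2 * μ - 1) := by
          refine mul_le_mul e ((abs_eval_geg_le hμ hu k).trans ?_) (abs_nonneg _) (by positivity)
          exact Real.rpow_le_rpow (by positivity) (by linarith) (by linarith)
      _ = _ := by
          nth_rewrite 1 [← Real.rpow_one ((4 + m + μ) * (n : ℝ))]
          rw [← Real.rpow_add (by positivity)]
          congr 1; ring
  refine (abs_sum_le_sum_abs _ _).trans ((sum_le_sum key).trans ?_)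
  rw [sum_const, card_range, nsmul_eq_mul, Real.mul_rpow (by positivity) (by positivity),
    Real.rpow_add (by positivity), Real.rpow_one]
  have h1 : ((4 * n + m : ℕ) : ℝ) ≤ (4 + m) * n := by push_cast; nlinarith
  calc _ ≤ ((4 + m) * n) * (B * ((4 + m + μ) ^ (2 * μ) * (n : ℝ) ^ (2 * μ))) := by gcongr
    _ = _ := by ring

lemma exists_abs_cutSamples_le {a : ℝ → ℝ} (ha : IsCutoff a) :
    ∃ B, ∀ n k, |cutSamples a n k| ≤ B := by
  obtain ⟨B, hB⟩ := (isCompact_Icc (a := (0 : ℝ)) (b := 2)).exists_bound_of_continuousOn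
    (contDiff_extCutoff ha).continuous.continuousOn
  refine ⟨max B 1, fun n k => ?_⟩
  unfold cutSamples
  set t := ((k : ℝ) + 1) / (2 * n)
  rcases lt_or_ge t 0 with h | h
  · rw [extCutoff_of_le_one ha (by linarith), abs_one]; exact le_max_right _ _
  · rcases lt_or_ge 2 t with h2 | h2
    · rw [extCutoff_of_two_lt ha h2, abs_zero]; exact zero_le_one.trans (le_max_right _ _)
    · exact (hB t ⟨h, h2⟩).trans (le_max_left _ _)

lemma exists_abs_gegSum_mul_pow_le {a : ℝ → ℝ} (ha : IsCutoff a) {μ : ℝ} (hμ : 2 ≤ μ) (m : ℕ) :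
    ∃ C, ∀ n : ℕ, 0 < n → ∀ u : ℝ, |u| ≤ 1 →
      |gegSum μ a 0 n u| * ((n : ℝ) ^ 2 * (1 - u)) ^ m ≤ C * (n : ℝ) ^ (2 * μ + 1) := by
  obtain ⟨B, hB⟩ := exists_abs_cutSamples_le ha
  have hB0 : 0 ≤ B := (abs_nonneg _).trans (hB 0 0)
  set A : ℝ := (4 + (0 : ℕ)) * (4 + (0 : ℕ) + μ) ^ (2 * μ) * B with hA
  have hA0 : 0 ≤ A := by positivity
  have h0 : ∀ n : ℕ, 0 < n → ∀ u : ℝ, |u| ≤ 1 →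
      |gegSum μ a 0 n u| ≤ A * (n : ℝ) ^ (2 * μ + 1) := fun n hn u hu =>
    abs_gegSum_le hμ a 0 hn (hB n) hu
  rcases m with _ | m
  · exact ⟨A, fun n hn u hu => by simpa using h0 n hn u hu⟩
  obtain ⟨N, hN⟩ := (SymbolClass.recOp_iterate (by linarith : 0 < μ)
    (symbolClass_fdiff_cutSamples ha) m 0).decayBound
  set D : ℝ := (4 + (m + 1 : ℕ)) * (4 + (m + 1 : ℕ) + μ) ^ (2 * μ) * N with hD
  have hD0 : 0 ≤ D := by positivity
  refine ⟨D + A * ((N : ℝ) ^ 2 * 2) ^ (m + 1), fun n hn u hu => ?_⟩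
  have hn' : (0 : ℝ) < n := by exact_mod_cast hn
  have hu1 : 0 ≤ 1 - u := by linarith [(abs_le.mp hu).2]
  have hu2 : 1 - u ≤ 2 := by linarith [(abs_le.mp hu).1]
  have hr : 0 ≤ (n : ℝ) ^ (2 * μ + 1) := by positivity
  rcases le_or_gt N n with h | h
  · have h1 := abs_gegSum_le hμ a (m + 1) hn (fun k => (hN n h hn k).1) hu
    rw [← pow_mul_gegSum ha (by linarith) hn, abs_mul, abs_of_nonneg (by positivity)] at h1
    calc |gegSum μ a 0 n u| * ((n : ℝ) ^ 2 * (1 - u)) ^ (m + 1)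
        = (n : ℝ) ^ (2 * (m + 1)) * ((1 - u) ^ (m + 1) * |gegSum μ a 0 n u|) := by
          rw [mul_pow, ← pow_mul]; ring
      _ ≤ (n : ℝ) ^ (2 * (m + 1)) * _ := mul_le_mul_of_nonneg_left h1 (by positivity)
      _ = D * (n : ℝ) ^ (2 * μ + 1) := by
        have hp : (n : ℝ) ^ (2 * (m + 1)) ≠ 0 := by positivity
        rw [hD]
        generalize (n : ℝ) ^ (2 * (m + 1)) = p at hp
        generalize (n : ℝ) ^ (2 * μ + 1) = q
        generalize (4 + ((m + 1 : ℕ) : ℝ)) * (4 + ((m + 1 : ℕ) : ℝ) + μ) ^ (2 * μ) = r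
        field_simp
      _ ≤ _ := by
        rw [add_mul]; exact le_add_of_nonneg_right (by positivity)
  · have hnN : (n : ℝ) ≤ N := by exact_mod_cast h.le
    calc |gegSum μ a 0 n u| * ((n : ℝ) ^ 2 * (1 - u)) ^ (m + 1)
        ≤ (A * (n : ℝ) ^ (2 * μ + 1)) * ((N : ℝ) ^ 2 * 2) ^ (m + 1) := by
          gcongr
          exact h0 n hn u hu
      _ ≤ _ := by
        rw [add_mul, mul_right_comm]; exact le_add_of_nonneg_left (by positivity)

/-- Localization of the Gegenbauer sums. -/
lemma exists_abs_gegSum_mul_one_add_pow_le {a : ℝ → ℝ} (ha : IsCutoff a) {μ : ℝ} (hμ : 2 ≤ μ)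
    (m : ℕ) : ∃ C, 0 ≤ C ∧ ∀ n : ℕ, 0 < n → ∀ u : ℝ, |u| ≤ 1 →
      |gegSum μ a 0 n u| * (1 + (n : ℝ) ^ 2 * (1 - u)) ^ m ≤ C * (n : ℝ) ^ (2 * μ + 1) := by
  obtain ⟨C₀, h₀⟩ := exists_abs_gegSum_mul_pow_le ha hμ 0
  obtain ⟨C₁, h₁⟩ := exists_abs_gegSum_mul_pow_le ha hμ m
  refine ⟨max 0 (2 ^ (m - 1) * (C₀ + C₁)), le_max_left _ _, fun n hn u hu => ?_⟩
  have hu1 : 0 ≤ 1 - u := by linarith [(abs_le.mp hu).2]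
  have h2 := add_pow_le zero_le_one (by positivity : 0 ≤ (n : ℝ) ^ 2 * (1 - u)) m
  rw [one_pow] at h2
  have h3 := h₀ n hn u hu
  have h4 := h₁ n hn u hu
  rw [pow_zero, mul_one] at h3
  calc _ ≤ |gegSum μ a 0 n u| * (2 ^ (m - 1) * (1 + ((n : ℝ) ^ 2 * (1 - u)) ^ m)) := by gcongr
    _ = 2 ^ (m - 1) * (|gegSum μ a 0 n u| +
          |gegSum μ a 0 n u| * ((n : ℝ) ^ 2 * (1 - u)) ^ m) := by ring
    _ ≤ 2 ^ (m - 1) * (C₀ * (n : ℝ) ^ (2 * μ + 1) + C₁ * (n : ℝ) ^ (2 * μ + 1)) := by gcongr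
    _ = (2 ^ (m - 1) * (C₀ + C₁)) * (n : ℝ) ^ (2 * μ + 1) := by ring
    _ ≤ _ := by
      have : (0 : ℝ) ≤ (n : ℝ) ^ (2 * μ + 1) := by positivity
      gcongr
      exact le_max_right _ _

/-- The density `t ^ (s - 1) / Γ(s)` on the half line. -/
def gdens (s t : ℝ) : ℝ := if 0 ≤ t then t ^ (s - 1) / Real.Gamma s else 0

lemma gdens_of_nonneg (s : ℝ) {t : ℝ} (ht : 0 ≤ t) : gdens s t = t ^ (s - 1) / Real.Gamma s :=
  if_pos ht

lemma gdens_of_neg (s : ℝ) {t : ℝ} (ht : t < 0) : gdens s t = 0 := if_neg (not_le.mpr ht)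

lemma gdens_nonneg {s : ℝ} (hs : 0 < s) (t : ℝ) : 0 ≤ gdens s t := by
  have := Real.Gamma_pos_of_pos hs
  unfold gdens
  split_ifs with h
  · positivity
  · exact le_rfl

@[fun_prop]
lemma measurable_gdens (s : ℝ) : Measurable (gdens s) :=
  Measurable.ite measurableSet_Ici (by fun_prop) (by fun_prop)

lemma lintegral_gdens_mul_gdens_one {s s' : ℝ} (hs : 1 ≤ s) (hs' : 1 ≤ s') :
    ∫⁻ t, ENNReal.ofReal (gdens s t * gdens s' (1 - t)) = ENNReal.ofReal (gdens (s + s') 1) := by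
  have h1 := Real.Gamma_pos_of_pos (by linarith : 0 < s)
  have h2 := Real.Gamma_pos_of_pos (by linarith : 0 < s')
  have h3 := Real.Gamma_pos_of_pos (by linarith : 0 < s + s')
  have e : (fun t => ENNReal.ofReal (gdens s t * gdens s' (1 - t))) =ᵐ[volume]
      fun t => ENNReal.ofReal (gdens (s + s') 1) * ProbabilityTheory.betaPDF s s' t := by
    filter_upwards [compl_mem_ae_iff.mpr (measure_singleton (0 : ℝ)),
      compl_mem_ae_iff.mpr (measure_singleton (1 : ℝ))] with t ht0 ht1
    rw [ProbabilityTheory.betaPDF_eq, gdens_of_nonneg _ zero_le_one, Real.one_rpow,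
      ← ENNReal.ofReal_mul (by positivity)]
    congr 1
    split_ifs with h
    · rw [gdens_of_nonneg _ h.1.le, gdens_of_nonneg _ (by linarith [h.2]), ProbabilityTheory.beta]
      field_simp
    · rw [not_and_or, not_lt, not_lt] at h
      rcases h with h | h
      · rw [gdens_of_neg _ (lt_of_le_of_ne h ht0)]; ring
      · rw [gdens_of_neg s' (t := 1 - t) (by linarith [lt_of_le_of_ne h (Ne.symm ht1)])]; ring
  rw [lintegral_congr_ae e, lintegral_const_mul' _ _ ENNReal.ofReal_ne_top,
    ProbabilityTheory.lintegral_betaPDF_eq_one (by linarith) (by linarith), mul_one]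

lemma lintegral_gdens_mul_gdens {s s' : ℝ} (hs : 1 ≤ s) (hs' : 1 ≤ s') (c : ℝ) :
    ∫⁻ t, ENNReal.ofReal (gdens s t * gdens s' (c - t)) = ENNReal.ofReal (gdens (s + s') c) := by
  rcases lt_trichotomy c 0 with hc | hc | hc
  · rw [gdens_of_neg _ hc, ENNReal.ofReal_zero, ← lintegral_zero (μ := (volume : Measure ℝ))]
    refine lintegral_congr fun t => ?_
    rcases lt_or_ge t 0 with ht | ht
    · rw [gdens_of_neg s ht, zero_mul, ENNReal.ofReal_zero]
    · rw [gdens_of_neg s' (t := c - t) (by linarith), mul_zero, ENNReal.ofReal_zero]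
  · subst hc
    rw [gdens_of_nonneg _ le_rfl, Real.zero_rpow (by linarith), zero_div, ENNReal.ofReal_zero,
      ← lintegral_zero (μ := (volume : Measure ℝ))]
    refine lintegral_congr_ae ?_
    filter_upwards [compl_mem_ae_iff.mpr (measure_singleton (0 : ℝ))] with t ht0
    rcases lt_or_ge t 0 with ht | ht
    · rw [gdens_of_neg s ht, zero_mul, ENNReal.ofReal_zero]
    · rw [gdens_of_neg s' (t := 0 - t) (by linarith [lt_of_le_of_ne ht (Ne.symm ht0)]), mul_zero,
        ENNReal.ofReal_zero]
  · have hm := Real.smul_map_volume_mul_left hc.ne'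
    conv_lhs => rw [← hm]
    rw [lintegral_smul_measure, lintegral_map (by fun_prop) (by fun_prop)]
    have hsc : ∀ (r t : ℝ), gdens r (c * t) = c ^ (r - 1) * gdens r t := by
      intro r t
      rcases lt_or_ge t 0 with ht | ht
      · rw [gdens_of_neg _ ht, gdens_of_neg _ (mul_neg_of_pos_of_neg hc ht), mul_zero]
      · rw [gdens_of_nonneg _ ht, gdens_of_nonneg _ (by positivity), Real.mul_rpow hc.le ht]
        ring
    have e : ∀ t, ENNReal.ofReal (gdens s (c * t) * gdens s' (c - c * t)) =
        ENNReal.ofReal (c ^ (s + s' - 2)) * ENNReal.ofReal (gdens s t * gdens s' (1 - t)) := by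
      intro t
      rw [show c - c * t = c * (1 - t) by ring, hsc, hsc, ← ENNReal.ofReal_mul (by positivity),
        show s + s' - 2 = (s - 1) + (s' - 1) by ring, Real.rpow_add hc]
      congr 1; ring
    rw [lintegral_congr e, lintegral_const_mul' _ _ ENNReal.ofReal_ne_top,
      lintegral_gdens_mul_gdens_one hs hs', smul_eq_mul, ← ENNReal.ofReal_mul (by positivity),
      ← ENNReal.ofReal_mul (by positivity), abs_of_pos hc]
    congr 1
    have := hsc (s + s') 1
    rw [mul_one] at this
    rw [this, ← mul_assoc]
    congr 1
    nth_rewrite 1 [← Real.rpow_one c]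
    rw [← Real.rpow_add hc]
    congr 1; ring

/-- The Dirichlet integral. -/
lemma lintegral_prod_gdens (d : ℕ) (s : Fin (d + 1) → ℝ) (hs : ∀ i, 1 ≤ s i) (c : ℝ) :
    ∫⁻ x : Fin d → ℝ, ENNReal.ofReal
        ((∏ i, gdens (s i.castSucc) (x i)) * gdens (s (Fin.last d)) (c - ∑ i, x i)) =
      ENNReal.ofReal (gdens (∑ i, s i) c) := by
  induction d generalizing c with
  | zero =>
    simp [volume_pi]
  | succ d ih =>
    have hmp := (volume_preserving_piFinSuccAbove (fun _ : Fin (d + 1) => ℝ) 0).symm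
    rw [← hmp.lintegral_comp (by fun_prop), Measure.volume_eq_prod, lintegral_prod _ (by fun_prop)]
    have hs1 : ∀ i, 0 < s i := fun i => by linarith [hs i]
    have e : ∀ x₀ : ℝ, ∀ x : Fin d → ℝ, ENNReal.ofReal
        ((∏ i, gdens (s i.castSucc) ((MeasurableEquiv.piFinSuccAbove (fun _ => ℝ) 0).symm (x₀, x) i))
          * gdens (s (Fin.last (d + 1)))
            (c - ∑ i, (MeasurableEquiv.piFinSuccAbove (fun _ => ℝ) 0).symm (x₀, x) i)) =
        ENNReal.ofReal (gdens (s 0) x₀) * ENNReal.ofReal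
          ((∏ i : Fin d, gdens (s i.castSucc.succ) (x i))
            * gdens (s (Fin.last d).succ) ((c - x₀) - ∑ i, x i)) := by
      intro x₀ x
      rw [← ENNReal.ofReal_mul (gdens_nonneg (hs1 _) _), Fin.prod_univ_succ, Fin.sum_univ_succ]
      simp [MeasurableEquiv.piFinSuccAbove, Fin.insertNthEquiv, mul_assoc, sub_sub]
    simp only [e]
    have e2 : ∀ x₀ : ℝ, ∫⁻ x : Fin d → ℝ, ENNReal.ofReal (gdens (s 0) x₀) * ENNReal.ofReal
          ((∏ i : Fin d, gdens (s i.castSucc.succ) (x i))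
            * gdens (s (Fin.last d).succ) ((c - x₀) - ∑ i, x i)) =
        ENNReal.ofReal (gdens (s 0) x₀ * gdens (∑ i : Fin (d + 1), s i.succ) (c - x₀)) := by
      intro x₀
      rw [lintegral_const_mul' _ _ ENNReal.ofReal_ne_top, ih (fun i => s i.succ) (fun i => hs _),
        ENNReal.ofReal_mul (gdens_nonneg (hs1 _) _)]
    simp only [e2]
    rw [lintegral_gdens_mul_gdens (hs 0), ← Fin.sum_univ_succ]
    calc (1 : ℝ) ≤ s (Fin.succ 0) := hs _
      _ ≤ _ := single_le_sum (f := fun i : Fin (d + 1) => s i.succ)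
          (fun i _ => (hs1 _).le) (mem_univ _)

section Simplex

variable {d : ℕ}

@[simp]
lemma xe_castSucc (x : Fin d → ℝ) (i : Fin d) : xe x i.castSucc = x i := by
  simp [xe]

@[simp]
lemma xe_last (x : Fin d → ℝ) : xe x (Fin.last d) = 1 - ∑ i, x i := by
  simp [xe]

lemma sum_xe (x : Fin d → ℝ) : ∑ k, xe x k = 1 := by
  simp [Fin.sum_univ_castSucc]

lemma mem_Splx_iff {x : Fin d → ℝ} : x ∈ Splx d ↔ ∀ k, 0 ≤ xe x k := by
  simp [Splx, Fin.forall_fin_succ']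

lemma Wk_eq_prod_xe (κ : Fin (d + 1) → ℝ) (x : Fin d → ℝ) : Wk κ x = ∏ k, xe x k ^ κ k := by
  simp [Wk, Fin.prod_univ_castSucc]

@[fun_prop]
lemma continuous_xe (k : Fin (d + 1)) : Continuous fun x : Fin d → ℝ => xe x k := by
  refine Fin.lastCases ?_ (fun i => ?_) k
  · simp only [xe_last]; fun_prop
  · simp only [xe_castSucc]; fun_prop

lemma continuous_Wk {κ : Fin (d + 1) → ℝ} (hκ : ∀ i, 0 ≤ κ i) : Continuous (Wk κ) := by
  simp only [funext (Wk_eq_prod_xe κ)]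
  exact continuous_finsetProd _ fun k _ => (continuous_xe k).rpow_const fun x => Or.inr (hκ k)

lemma isCompact_Splx : IsCompact (Splx d) := by
  have h1 : IsClosed (Splx d) := by
    have : Splx d = ⋂ k, {x | 0 ≤ xe x k} := by ext x; simp [mem_Splx_iff]
    rw [this]
    exact isClosed_iInter fun k => isClosed_le continuous_const (continuous_xe k)
  refine (isCompact_Icc (a := (0 : Fin d → ℝ)) (b := 1)).of_isClosed_subset h1 fun x hx => ?_
  refine ⟨hx.1, fun i => ?_⟩
  exact (single_le_sum (fun j _ => hx.1 j) (mem_univ i)).trans hx.2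

lemma measurableSet_Splx : MeasurableSet (Splx d) := isCompact_Splx.isClosed.measurableSet

lemma integrableOn_mul_Wk {κ : Fin (d + 1) → ℝ} (hκ : ∀ i, 0 ≤ κ i) {f : (Fin d → ℝ) → ℝ}
    (hf : Continuous f) : IntegrableOn (fun x => f x * Wk κ x) (Splx d) :=
  (hf.mul (continuous_Wk hκ)).continuousOn.integrableOn_compact isCompact_Splx

lemma Wk_nonneg (κ : Fin (d + 1) → ℝ) {x : Fin d → ℝ} (hx : x ∈ Splx d) : 0 ≤ Wk κ x := by
  rw [Wk_eq_prod_xe]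
  exact prod_nonneg fun k _ => Real.rpow_nonneg (mem_Splx_iff.mp hx k) _

lemma bk_pos {κ : Fin (d + 1) → ℝ} (hκ : ∀ i, 0 ≤ κ i) : 0 < bk κ := by
  have : 0 ≤ ∑ i, κ i := sum_nonneg fun i _ => hκ i
  exact div_pos (Real.Gamma_pos_of_pos (by positivity))
    (prod_pos fun i _ => Real.Gamma_pos_of_pos (by linarith [hκ i]))

lemma Gamma_add_natCast {c : ℝ} (hc : 0 < c) (n : ℕ) :
    Real.Gamma (c + n) = rf c n * Real.Gamma c := by
  induction n with
  | zero => simp [rf_zero]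
  | succ n ih =>
    rw [Nat.cast_succ, ← add_assoc, Real.Gamma_add_one (by positivity), ih, rf_succ]
    ring

/-- The moments of the Jacobi weight on the simplex. -/
lemma bk_mul_integral_prod_xe_pow {κ : Fin (d + 1) → ℝ} (hκ : ∀ i, 0 ≤ κ i)
    (β : Fin (d + 1) → ℕ) :
    bk κ * ∫ x in Splx d, (∏ k, xe x k ^ β k) * Wk κ x =
      (∏ k, rf (κ k + 1) (β k)) / rf ((∑ k, κ k) + d + 1) (∑ k, β k) := by
  have hκ1 : ∀ k, 0 < κ k + 1 := fun k => by linarith [hκ k]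
  have hsum : 0 ≤ ∑ i, κ i := sum_nonneg fun i _ => hκ i
  set s : Fin (d + 1) → ℝ := fun k => κ k + 1 + β k with hs
  have hs1 : ∀ k, 1 ≤ s k := fun k => by
    have : (0 : ℝ) ≤ β k := (β k).cast_nonneg
    simp only [hs]; linarith [hκ k]
  have hΓ : ∀ k, 0 < Real.Gamma (s k) := fun k => Real.Gamma_pos_of_pos (by linarith [hs1 k])
  have hG : ∀ x : Fin d → ℝ, (∏ i, gdens (s i.castSucc) (x i)) *
      gdens (s (Fin.last d)) (1 - ∑ i, x i) = ∏ k, gdens (s k) (xe x k) := fun x => by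
    simp [Fin.prod_univ_castSucc]
  have e : ∀ x, (Splx d).indicator (fun x => (∏ k, xe x k ^ β k) * Wk κ x) x =
      (∏ k, Real.Gamma (s k)) * ∏ k, gdens (s k) (xe x k) := by
    intro x
    by_cases hx : x ∈ Splx d
    · rw [Set.indicator_of_mem hx, Wk_eq_prod_xe, ← prod_mul_distrib, ← prod_mul_distrib]
      refine prod_congr rfl fun k _ => ?_
      have hk := mem_Splx_iff.mp hx k
      rw [gdens_of_nonneg _ hk, mul_div_cancel₀ _ (hΓ k).ne', hs,
        show κ k + 1 + β k - 1 = κ k + β k by ring,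
        Real.rpow_add_of_nonneg hk (hκ k) (Nat.cast_nonneg _), Real.rpow_natCast, mul_comm]
    · rw [Set.indicator_of_notMem hx]
      rw [mem_Splx_iff] at hx
      push Not at hx
      obtain ⟨k, hk⟩ := hx
      rw [prod_eq_zero (f := fun k => gdens (s k) (xe x k)) (mem_univ k) (gdens_of_neg _ hk),
        mul_zero]
  have hS : ∑ k, s k = (∑ k, κ k) + d + 1 + (∑ k, β k : ℕ) := by
    simp only [hs, sum_add_distrib, sum_const, card_univ, Fintype.card_fin, nsmul_eq_mul, mul_one]
    push_cast
    ring
  have hdir : ∫ x : Fin d → ℝ, ∏ k, gdens (s k) (xe x k) = (Real.Gamma (∑ k, s k))⁻¹ := by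
    rw [integral_eq_lintegral_of_nonneg_ae
      (Filter.Eventually.of_forall fun x => prod_nonneg fun k _ =>
        gdens_nonneg (by linarith [hs1 k]) _)
      (Finset.measurable_prod _ fun k _ =>
        (measurable_gdens _).comp (continuous_xe k).measurable).aestronglyMeasurable]
    simp only [← hG]
    have hSpos : 0 < ∑ k, s k := by rw [hS]; positivity
    rw [lintegral_prod_gdens d s hs1 1, gdens_of_nonneg _ zero_le_one, Real.one_rpow, one_div,
      ENNReal.toReal_ofReal (inv_nonneg.mpr (Real.Gamma_pos_of_pos hSpos).le)]
  rw [← integral_indicator measurableSet_Splx, integral_congr_ae (Filter.Eventually.of_forall e),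
    integral_const_mul, hdir, hS, Gamma_add_natCast (by positivity), bk]
  simp only [hs, Gamma_add_natCast (hκ1 _), prod_mul_distrib]
  have h1 : (∏ k, Real.Gamma (κ k + 1)) ≠ 0 :=
    (prod_pos fun k _ => Real.Gamma_pos_of_pos (hκ1 k)).ne'
  have h2 : Real.Gamma ((∑ k, κ k) + d + 1) ≠ 0 := (Real.Gamma_pos_of_pos (by positivity)).ne'
  have h3 : rf ((∑ k, κ k) + d + 1) (∑ k, β k) ≠ 0 := (rf_pos (by positivity) _).ne'
  field_simp

end Simplex

lemma exists_rf_add_eq_sum_descFactorial (c : ℝ) (β : ℕ) :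
    ∃ w : ℕ → ℝ, w β = 1 ∧
      ∀ a : ℕ, rf (c + a) β = ∑ j ∈ range (β + 1), w j * a.descFactorial j := by
  induction β with
  | zero => exact ⟨fun _ => 1, rfl, fun a => by simp [rf_zero]⟩
  | succ β ih =>
    obtain ⟨w, hw, h⟩ := ih
    refine ⟨fun j => (if j = 0 then 0 else w (j - 1)) + (if j ≤ β then (c + β + j) * w j else 0),
      by simp [hw], fun a => ?_⟩
    have hd : ∀ j : ℕ, (a : ℝ) * a.descFactorial j =
        a.descFactorial (j + 1) + j * a.descFactorial j := by
      intro j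
      rw [Nat.descFactorial_succ]
      rcases le_or_gt j a with hj | hj
      · push_cast [Nat.cast_sub hj]; ring
      · rw [Nat.descFactorial_of_lt hj]; simp
    have e1 : ∑ j ∈ range (β + 1 + 1), (if j = 0 then 0 else w (j - 1)) * (a.descFactorial j : ℝ) =
        ∑ j ∈ range (β + 1), w j * a.descFactorial (j + 1) := by
      rw [sum_range_succ']
      simp
    have e2 : ∑ j ∈ range (β + 1 + 1), (if j ≤ β then (c + β + j) * w j else 0)
          * (a.descFactorial j : ℝ) =
        ∑ j ∈ range (β + 1), (c + β + j) * w j * a.descFactorial j := by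
      rw [sum_range_succ]
      simp only [show ¬ (β + 1 ≤ β) by omega, if_false, zero_mul, add_zero]
      refine sum_congr rfl fun j hj => ?_
      rw [if_pos (by have := mem_range.mp hj; omega)]
    simp only [add_mul] at e2 ⊢
    rw [sum_add_distrib, e1, e2, ← sum_add_distrib, rf_succ, h, sum_mul]
    refine sum_congr rfl fun j _ => ?_
    linear_combination w j * hd j

lemma sum_piAntidiag_prod_div_factorial {ι : Type*} [Fintype ι] [DecidableEq ι]
    (X : ι → ℝ) (m : ℕ) :
    ∑ α ∈ piAntidiag (univ : Finset ι) m, ∏ i, X i ^ α i / (α i)! = (∑ i, X i) ^ m / m ! := by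
  rw [sum_pow_eq_sum_piAntidiag, sum_div]
  refine sum_congr rfl fun α hα => ?_
  have h := Nat.multinomial_spec (univ : Finset ι) α
  rw [(mem_piAntidiag.mp hα).1] at h
  have h1 : ((∏ i, (α i)! : ℕ) : ℝ) ≠ 0 := by
    exact_mod_cast (prod_pos fun i _ => Nat.factorial_pos (α i)).ne'
  have h2 : (m ! : ℝ) ≠ 0 := by positivity
  rw [prod_div_distrib, div_eq_div_iff (by exact_mod_cast h1) h2, ← h]
  push_cast
  ring

lemma sum_piAntidiag_prod_descFactorial {ι : Type*} [Fintype ι] [DecidableEq ι] (X : ι → ℝ)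
    (γ : ι → ℕ) (m : ℕ) :
    ∑ α ∈ piAntidiag (univ : Finset ι) m, ∏ i, X i ^ α i / (α i)! * (α i).descFactorial (γ i) =
      if ∑ i, γ i ≤ m then (∏ i, X i ^ γ i) * ((∑ i, X i) ^ (m - ∑ i, γ i) / (m - ∑ i, γ i)!)
      else 0 := by
  have hzero : ∀ α : ι → ℕ, ¬ γ ≤ α →
      ∏ i, X i ^ α i / (α i)! * ((α i).descFactorial (γ i) : ℝ) = 0 := by
    intro α h
    rw [Pi.le_def] at h
    push Not at h
    obtain ⟨i, hi⟩ := h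
    exact prod_eq_zero (mem_univ i) (by rw [Nat.descFactorial_of_lt hi]; simp)
  split_ifs with hm
  · rw [← sum_piAntidiag_prod_div_factorial, mul_sum]
    symm
    refine sum_of_injOn (fun δ => δ + γ) (fun _ _ _ _ h => add_right_cancel h) ?_ ?_ ?_
    · intro δ hδ
      have h1 : ∑ i, δ i = m - ∑ i, γ i := (mem_piAntidiag.mp hδ).1
      refine mem_piAntidiag.mpr ⟨?_, by simp⟩
      simp only [Pi.add_apply, sum_add_distrib]
      omega
    · intro α hα hn
      refine hzero α fun h => hn ⟨α - γ, ?_, tsub_add_cancel_of_le h⟩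
      refine mem_piAntidiag.mpr ⟨?_, by simp⟩
      have h1 : ∑ i, α i = m := (mem_piAntidiag.mp hα).1
      change ∑ i, (α - γ) i = m - ∑ i, γ i
      have h2 : ∑ i, (α - γ) i + ∑ i, γ i = ∑ i, α i := by
        rw [← sum_add_distrib]
        exact sum_congr rfl fun i _ => Nat.sub_add_cancel (h i)
      omega
    · intro δ _
      rw [← prod_mul_distrib]
      refine prod_congr rfl fun i _ => ?_
      have h3 := Nat.factorial_mul_descFactorial (Nat.le_add_left (γ i) (δ i))
      rw [Nat.add_sub_cancel] at h3
      have h4 : ((δ i)! : ℝ) ≠ 0 := by positivity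
      have h5 : ((δ i + γ i)! : ℝ) ≠ 0 := by positivity
      have h6 : ((δ i)! : ℝ) * ((δ i + γ i).descFactorial (γ i) : ℝ) = ((δ i + γ i)! : ℝ) := by
        exact_mod_cast h3
      simp only [Pi.add_apply]
      rw [← h6]
      have h7 : ((δ i + γ i).descFactorial (γ i) : ℝ) ≠ 0 := by
        intro h; rw [h, mul_zero] at h6; exact h5 h6.symm
      field_simp
      ring
  · refine sum_eq_zero fun α hα => hzero α fun h => hm ?_
    rw [← (mem_piAntidiag.mp hα).1]
    exact sum_le_sum fun i _ => h i

/-- The coefficients of the reproducing kernel of degree `k`. -/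
def kernelCoeff (l : ℝ) (k m : ℕ) : ℝ :=
  (2 * k + l) / l * ((-1) ^ (k - m) * rf l (k + m) / (k - m)!)

lemma alternating_sum_choose_mul_eval_eq_zero {p : Polynomial ℝ} {N : ℕ} (hp : p.natDegree < N) :
    ∑ r ∈ range (N + 1), (-1 : ℝ) ^ (N - r) * N.choose r * p.eval (r : ℝ) = 0 := by
  have h := congr_fun (Polynomial.fwdDiff_iter_eq_zero_of_degree_lt hp) 0
  rw [fwdDiff_iter_eq_sum_shift] at h
  simpa using h

lemma sum_kernelCoeff_eq_zero {l : ℝ} (hl : 0 < l) {k b g : ℕ} (hgb : g ≤ b) (hbk : b < k) :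
    ∑ m ∈ range (k + 1), kernelCoeff l k m / rf (l + 1) (m + b)
      * (if g ≤ m then 1 / ((m - g)! : ℝ) else 0) = 0 := by
  obtain ⟨N, rfl⟩ := Nat.exists_eq_add_of_le (hgb.trans hbk.le)
  have hN : (N ! : ℝ) ≠ 0 := by positivity
  set D := g + N - 1 - b with hD
  set p : Polynomial ℝ := ∏ i ∈ range D, (Polynomial.X + Polynomial.C (l + 1 + g + b + i)) with hp
  have hdeg : p.natDegree < N := by
    refine (Polynomial.natDegree_prod_le _ _).trans_lt ?_
    simp only [Polynomial.natDegree_X_add_C, sum_const, card_range, smul_eq_mul, mul_one]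
    omega
  have hz := alternating_sum_choose_mul_eval_eq_zero hdeg
  have hshift : ∑ m ∈ range (g + N + 1), kernelCoeff l (g + N) m / rf (l + 1) (m + b)
      * (if g ≤ m then 1 / ((m - g)! : ℝ) else 0) =
      ∑ r ∈ range (N + 1), kernelCoeff l (g + N) (g + r) / rf (l + 1) (g + r + b) *
        (1 / (r ! : ℝ)) := by
    rw [add_assoc, sum_range_add]
    rw [sum_eq_zero, zero_add]
    · refine sum_congr rfl fun r _ => ?_
      rw [if_pos (by omega), Nat.add_sub_cancel_left]
    · intro m hm
      rw [if_neg (by have := mem_range.mp hm; omega), mul_zero]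
  rw [hshift]
  have hterm : ∀ r ∈ range (N + 1),
      kernelCoeff l (g + N) (g + r) / rf (l + 1) (g + r + b) * (1 / (r ! : ℝ)) =
      ((2 * (g + N : ℕ) + l) / N !) * ((-1 : ℝ) ^ (N - r) * N.choose r * p.eval (r : ℝ)) := by
    intro r hr
    have hr' : r ≤ N := by have := mem_range.mp hr; omega
    have e1 : p.eval (r : ℝ) = rf (l + 1 + (g + r + b : ℕ)) D := by
      rw [hp, Polynomial.eval_prod, rf]
      refine prod_congr rfl fun i _ => ?_
      simp; ring
    have e2 : rf l (g + N + (g + r)) =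
        l * (rf (l + 1) (g + r + b) * rf (l + 1 + (g + r + b : ℕ)) D) := by
      rw [← rf_add, ← rf_succ']
      congr 1; omega
    have h1 : rf (l + 1) (g + r + b) ≠ 0 := (rf_pos (by positivity) _).ne'
    have h2 : ((N - r)! : ℝ) ≠ 0 := by positivity
    have h3 : (r ! : ℝ) ≠ 0 := by positivity
    rw [kernelCoeff, e1, e2, show g + N - (g + r) = N - r by omega, Nat.cast_choose ℝ hr']
    field_simp
  rw [sum_congr rfl hterm, ← mul_sum, hz, mul_zero]

lemma sum_kernelCoeff_eq_one {l : ℝ} (hl : 0 < l) (k : ℕ) :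
    ∑ m ∈ range (k + 1), kernelCoeff l k m / rf (l + 1) (m + k)
      * (if k ≤ m then 1 / ((m - k)! : ℝ) else 0) = 1 := by
  rw [sum_range_succ, sum_eq_zero, zero_add]
  · have h1 : rf (l + 1) (k + k) ≠ 0 := (rf_pos (by positivity) _).ne'
    have h2 : rf l (k + k) * (l + (k + k : ℕ)) = l * rf (l + 1) (k + k) := by
      rw [← rf_succ, ← rf_succ']
    rw [kernelCoeff, if_pos le_rfl]
    simp only [Nat.sub_self, pow_zero, Nat.factorial_zero, Nat.cast_one, one_mul, div_one, mul_one]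
    rw [div_mul_eq_mul_div, div_div, div_eq_one_iff_eq (by positivity), ← h2]
    push_cast
    ring
  · intro m hm
    rw [if_neg (by have := mem_range.mp hm; omega), mul_zero]

section Kernel

variable {d : ℕ}

/-- The homogeneous building blocks of the reproducing kernels. -/
def homKernel (κ : Fin (d + 1) → ℝ) (m : ℕ) (x y : Fin d → ℝ) : ℝ :=
  ∑ α ∈ piAntidiag (univ : Finset (Fin (d + 1))) m,
    ∏ i, (xe x i * xe y i) ^ α i / ((α i)! * rf (κ i + 1) (α i))

/-- An explicit formula for the reproducing kernels of the Jacobi weight on the simplex. -/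
def repKernel (κ : Fin (d + 1) → ℝ) (k : ℕ) (x y : Fin d → ℝ) : ℝ :=
  ∑ m ∈ range (k + 1), kernelCoeff ((∑ i, κ i) + d) k m * homKernel κ m x y

lemma repKernel_comm (κ : Fin (d + 1) → ℝ) (k : ℕ) (x y : Fin d → ℝ) :
    repKernel κ k x y = repKernel κ k y x := by
  simp only [repKernel, homKernel, mul_comm]

lemma bk_mul_integral_homKernel_mul {κ : Fin (d + 1) → ℝ} (hκ : ∀ i, 0 ≤ κ i)
    (β : Fin (d + 1) → ℕ) {w : Fin (d + 1) → ℕ → ℝ}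
    (hw : ∀ i, ∀ a : ℕ, rf (κ i + 1 + a) (β i) = ∑ j ∈ range (β i + 1), w i j * a.descFactorial j)
    (m : ℕ) (x : Fin d → ℝ) :
    bk κ * ∫ y in Splx d, homKernel κ m x y * (∏ i, xe y i ^ β i) * Wk κ y =
      ∑ γ ∈ Fintype.piFinset fun i => range (β i + 1), (∏ i, w i (γ i)) * (∏ i, xe x i ^ γ i) *
        (1 / rf ((∑ i, κ i) + d + 1) (m + ∑ i, β i) *
          if ∑ i, γ i ≤ m then 1 / ((m - ∑ i, γ i)! : ℝ) else 0) := by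
  have hr : ∀ i n, rf (κ i + 1) n ≠ 0 := fun i n => (rf_pos (by linarith [hκ i]) n).ne'
  have e1 : ∀ y, homKernel κ m x y * (∏ i, xe y i ^ β i) * Wk κ y =
      ∑ α ∈ piAntidiag (univ : Finset (Fin (d + 1))) m,
        (∏ i, xe x i ^ α i / ((α i)! * rf (κ i + 1) (α i))) *
          ((∏ i, xe y i ^ (α i + β i)) * Wk κ y) := by
    intro y
    rw [homKernel, sum_mul, sum_mul]
    refine sum_congr rfl fun α _ => ?_
    rw [← mul_assoc, ← prod_mul_distrib, ← prod_mul_distrib]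
    congr 1
    refine prod_congr rfl fun i _ => ?_
    rw [mul_pow, pow_add]
    ring
  simp only [e1]
  rw [integral_finsetSum _ fun α _ => (integrableOn_mul_Wk hκ (by fun_prop)).const_mul _, mul_sum]
  have e2 : ∀ α ∈ piAntidiag (univ : Finset (Fin (d + 1))) m,
      bk κ * ∫ y in Splx d, (∏ i, xe x i ^ α i / ((α i)! * rf (κ i + 1) (α i))) *
          ((∏ i, xe y i ^ (α i + β i)) * Wk κ y) =
        1 / rf ((∑ i, κ i) + d + 1) (m + ∑ i, β i) *
          ∑ γ ∈ Fintype.piFinset fun i => range (β i + 1),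
            (∏ i, w i (γ i)) * ∏ i, xe x i ^ α i / (α i)! * (α i).descFactorial (γ i) := by
    intro α hα
    have hm : ∑ i, (α i + β i) = m + ∑ i, β i := by
      rw [sum_add_distrib]
      congr 1
      exact (mem_piAntidiag.mp hα).1
    rw [integral_const_mul, mul_left_comm, bk_mul_integral_prod_xe_pow hκ, hm, mul_div_assoc',
      div_eq_mul_one_div, mul_comm]
    congr 1
    simp only [← prod_mul_distrib]
    refine Eq.trans (prod_congr rfl fun i _ => ?_) (prod_univ_sum (fun i => range (β i + 1))
      fun i j => w i j * (xe x i ^ α i / (α i)! * (α i).descFactorial j))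
    rw [rf_add, hw]
    have := hr i (α i)
    rw [mul_sum, mul_sum]
    refine sum_congr rfl fun j _ => ?_
    field_simp
  rw [sum_congr rfl e2, ← mul_sum, sum_comm, mul_sum]
  refine sum_congr rfl fun γ _ => ?_
  rw [← mul_sum, sum_piAntidiag_prod_descFactorial, sum_xe, one_pow]
  split_ifs
  · ring
  · ring

lemma bk_mul_integral_repKernel_mul {κ : Fin (d + 1) → ℝ} (hκ : ∀ i, 0 ≤ κ i)
    (β : Fin (d + 1) → ℕ) {w : Fin (d + 1) → ℕ → ℝ}
    (hw : ∀ i, ∀ a : ℕ, rf (κ i + 1 + a) (β i) = ∑ j ∈ range (β i + 1), w i j * a.descFactorial j)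
    (k : ℕ) (x : Fin d → ℝ) :
    bk κ * ∫ y in Splx d, repKernel κ k x y * (∏ i, xe y i ^ β i) * Wk κ y =
      ∑ γ ∈ Fintype.piFinset fun i => range (β i + 1), (∏ i, w i (γ i)) * (∏ i, xe x i ^ γ i) *
        ∑ m ∈ range (k + 1), kernelCoeff ((∑ i, κ i) + d) k m /
          rf ((∑ i, κ i) + d + 1) (m + ∑ i, β i) *
            if ∑ i, γ i ≤ m then 1 / ((m - ∑ i, γ i)! : ℝ) else 0 := by
  have e1 : ∀ y, repKernel κ k x y * (∏ i, xe y i ^ β i) * Wk κ y =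
      ∑ m ∈ range (k + 1), kernelCoeff ((∑ i, κ i) + d) k m *
        (homKernel κ m x y * (∏ i, xe y i ^ β i) * Wk κ y) := by
    intro y
    rw [repKernel, sum_mul, sum_mul]
    exact sum_congr rfl fun m _ => by ring
  simp only [e1]
  rw [integral_finsetSum _ fun m _ =>
    (integrableOn_mul_Wk hκ (by unfold homKernel; fun_prop)).const_mul _,
    mul_sum]
  simp only [integral_const_mul, mul_left_comm (bk κ)]
  simp only [bk_mul_integral_homKernel_mul hκ β hw, mul_sum]
  rw [sum_comm]
  refine sum_congr rfl fun γ _ => sum_congr rfl fun m _ => ?_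
  ring

/-- The function `xe · k` as a polynomial. -/
def xePoly (k : Fin (d + 1)) : MvPolynomial (Fin d) ℝ :=
  Fin.lastCases (motive := fun _ => MvPolynomial (Fin d) ℝ) (1 - ∑ i, MvPolynomial.X i)
    (fun i => MvPolynomial.X i) k

@[simp]
lemma eval_xePoly (x : Fin d → ℝ) (k : Fin (d + 1)) :
    MvPolynomial.eval x (xePoly k) = xe x k := by
  refine Fin.lastCases ?_ (fun i => ?_) k <;> simp [xePoly]

lemma totalDegree_xePoly_le (k : Fin (d + 1)) :
    (xePoly k : MvPolynomial (Fin d) ℝ).totalDegree ≤ 1 := by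
  refine Fin.lastCases ?_ (fun i => ?_) k
  · simp only [xePoly, Fin.lastCases_last]
    refine (MvPolynomial.totalDegree_sub _ _).trans (max_le (by simp) ?_)
    exact MvPolynomial.totalDegree_finsetSum_le fun i _ => by simp
  · simp [xePoly]

lemma totalDegree_prod_xePoly_pow_le (γ : Fin (d + 1) → ℕ) :
    (∏ k, xePoly k ^ γ k : MvPolynomial (Fin d) ℝ).totalDegree ≤ ∑ k, γ k := by
  refine (MvPolynomial.totalDegree_finsetProd _ _).trans (sum_le_sum fun k _ => ?_)
  refine (MvPolynomial.totalDegree_pow _ _).trans ?_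
  simpa using Nat.mul_le_mul_left (γ k) (totalDegree_xePoly_le k)

/-- The polynomials of degree less than `k`. -/
def lowDegree (d k : ℕ) : Submodule ℝ (MvPolynomial (Fin d) ℝ) :=
  Submodule.span ℝ {p | ∃ γ : Fin (d + 1) → ℕ, ∑ i, γ i < k ∧ p = ∏ i, xePoly i ^ γ i}

lemma eval_eq_sum_prod_xe (g : MvPolynomial (Fin d) ℝ) (x : Fin d → ℝ) :
    MvPolynomial.eval x g = ∑ s ∈ g.support, g.coeff s *
      ∏ i, xe x i ^ (Fin.snoc (α := fun _ => ℕ) (fun i => s i) 0 : Fin (d + 1) → ℕ) i := by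
  rw [MvPolynomial.eval_eq']
  refine sum_congr rfl fun s _ => ?_
  simp [Fin.prod_univ_castSucc]

lemma sum_snoc_le (g : MvPolynomial (Fin d) ℝ) {s : Fin d →₀ ℕ} (hs : s ∈ g.support) :
    ∑ i, (Fin.snoc (α := fun _ => ℕ) (fun i => s i) 0 : Fin (d + 1) → ℕ) i ≤ g.totalDegree := by
  refine le_trans (le_of_eq ?_) (MvPolynomial.le_totalDegree hs)
  simp [Fin.sum_univ_castSucc, Finsupp.sum_fintype]

/-- The explicit kernel in the variable `x` as a polynomial. -/
def repKernelPoly (κ : Fin (d + 1) → ℝ) (k : ℕ) (y : Fin d → ℝ) : MvPolynomial (Fin d) ℝ :=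
  ∑ m ∈ range (k + 1), ∑ α ∈ piAntidiag (univ : Finset (Fin (d + 1))) m,
    MvPolynomial.C (kernelCoeff ((∑ i, κ i) + d) k m *
      ∏ i, xe y i ^ α i / ((α i)! * rf (κ i + 1) (α i))) * ∏ i, xePoly i ^ α i

lemma eval_repKernelPoly (κ : Fin (d + 1) → ℝ) (k : ℕ) (x y : Fin d → ℝ) :
    MvPolynomial.eval x (repKernelPoly κ k y) = repKernel κ k x y := by
  simp only [repKernelPoly, repKernel, homKernel, map_sum, mul_sum]
  refine sum_congr rfl fun m _ => sum_congr rfl fun α _ => ?_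
  simp only [map_mul, MvPolynomial.eval_C, map_prod, map_pow, eval_xePoly]
  rw [mul_assoc, ← prod_mul_distrib]
  congr 1
  refine prod_congr rfl fun i _ => ?_
  rw [mul_pow]; ring

lemma totalDegree_repKernelPoly_le (κ : Fin (d + 1) → ℝ) (k : ℕ) (y : Fin d → ℝ) :
    (repKernelPoly κ k y).totalDegree ≤ k := by
  refine MvPolynomial.totalDegree_finsetSum_le fun m hm =>
    MvPolynomial.totalDegree_finsetSum_le fun α hα => ?_
  refine (MvPolynomial.totalDegree_mul _ _).trans ?_
  rw [MvPolynomial.totalDegree_C, zero_add]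
  refine (totalDegree_prod_xePoly_pow_le α).trans ?_
  have h1 : ∑ i, α i = m := (mem_piAntidiag.mp hα).1
  have := mem_range.mp hm
  omega

@[fun_prop]
lemma continuous_repKernel (κ : Fin (d + 1) → ℝ) (k : ℕ) (x : Fin d → ℝ) :
    Continuous fun y => repKernel κ k x y := by
  unfold repKernel homKernel
  fun_prop

variable {κ : Fin (d + 1) → ℝ}

lemma add_natCast_pos (hκ : ∀ i, 0 ≤ κ i) (hd : 0 < d) : 0 < (∑ i, κ i) + (d : ℝ) := by
  have : 0 ≤ ∑ i, κ i := sum_nonneg fun i _ => hκ i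
  positivity

lemma bk_mul_integral_repKernel_mul_eq_zero (hκ : ∀ i, 0 ≤ κ i) (hd : 0 < d) {k : ℕ}
    {β : Fin (d + 1) → ℕ} (hβ : ∑ i, β i < k) (x : Fin d → ℝ) :
    bk κ * ∫ y in Splx d, repKernel κ k x y * (∏ i, xe y i ^ β i) * Wk κ y = 0 := by
  choose w _ hw using fun i => exists_rf_add_eq_sum_descFactorial (κ i + 1) (β i)
  rw [bk_mul_integral_repKernel_mul hκ β hw]
  refine sum_eq_zero fun γ hγ => ?_
  rw [sum_kernelCoeff_eq_zero (add_natCast_pos hκ hd) _ hβ, mul_zero]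
  refine sum_le_sum fun i _ => ?_
  have := mem_range.mp (Fintype.mem_piFinset.mp hγ i)
  omega

lemma exists_lowDegree_integral_repKernel_mul_prod (hκ : ∀ i, 0 ≤ κ i) (hd : 0 < d) {k : ℕ}
    {β : Fin (d + 1) → ℕ} (hβ : ∑ i, β i = k) :
    ∃ q ∈ lowDegree d k, ∀ x,
      bk κ * ∫ y in Splx d, repKernel κ k x y * (∏ i, xe y i ^ β i) * Wk κ y =
        (∏ i, xe x i ^ β i) + MvPolynomial.eval x q := by
  choose w hw1 hw using fun i => exists_rf_add_eq_sum_descFactorial (κ i + 1) (β i)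
  have hle : ∀ γ ∈ Fintype.piFinset fun i => range (β i + 1), ∀ i, γ i ≤ β i := by
    intro γ hγ i
    have := mem_range.mp (Fintype.mem_piFinset.mp hγ i)
    omega
  set c : (Fin (d + 1) → ℕ) → ℝ := fun γ => ∑ m ∈ range (k + 1), kernelCoeff ((∑ i, κ i) + d) k m /
          rf ((∑ i, κ i) + d + 1) (m + ∑ i, β i) *
            if ∑ i, γ i ≤ m then 1 / ((m - ∑ i, γ i)! : ℝ) else 0 with hc
  refine ⟨∑ γ ∈ (Fintype.piFinset fun i => range (β i + 1)).erase β,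
    ((∏ i, w i (γ i)) * c γ) • ∏ i, xePoly i ^ γ i, ?_, fun x => ?_⟩
  · refine Submodule.sum_mem _ fun γ hγ => Submodule.smul_mem _ _ (Submodule.subset_span ⟨γ, ?_, rfl⟩)
    rw [mem_erase] at hγ
    rw [← hβ]
    have h1 := hle γ hγ.2
    obtain ⟨i, hi⟩ := Function.ne_iff.mp hγ.1
    exact sum_lt_sum (fun i _ => h1 i) ⟨i, mem_univ i, lt_of_le_of_ne (h1 i) hi⟩
  · rw [bk_mul_integral_repKernel_mul hκ β hw]
    rw [← add_sum_erase (a := β) _ _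
      (Fintype.mem_piFinset.mpr fun i => mem_range.mpr (Nat.lt_succ_self _))]
    congr 1
    · rw [hβ, sum_kernelCoeff_eq_one (add_natCast_pos hκ hd)]
      simp [hw1]
    · rw [map_sum]
      refine sum_congr rfl fun γ _ => ?_
      simp only [MvPolynomial.smul_eval, map_prod, map_pow, eval_xePoly]
      ring

lemma exists_lowDegree_integral_repKernel_mul (hκ : ∀ i, 0 ≤ κ i) (hd : 0 < d) {k : ℕ}
    {p : MvPolynomial (Fin d) ℝ} (hp : p.totalDegree ≤ k) :
    ∃ q ∈ lowDegree d k, ∀ x,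
      bk κ * ∫ y in Splx d, repKernel κ k x y * MvPolynomial.eval y p * Wk κ y =
        MvPolynomial.eval x p + MvPolynomial.eval x q := by
  set e : (Fin d →₀ ℕ) → Fin (d + 1) → ℕ := fun s => Fin.snoc (α := fun _ => ℕ) (fun i => s i) 0
  have key : ∀ s ∈ p.support, ∃ q ∈ lowDegree d k, ∀ x,
      bk κ * ∫ y in Splx d, repKernel κ k x y * (∏ i, xe y i ^ e s i) * Wk κ y =
        (∏ i, xe x i ^ e s i) + MvPolynomial.eval x q := by
    intro s hs
    rcases ((sum_snoc_le p hs).trans hp).lt_or_eq with h | h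
    · refine ⟨-∏ i, xePoly i ^ e s i,
        Submodule.neg_mem _ (Submodule.subset_span ⟨_, h, rfl⟩), fun x => ?_⟩
      rw [bk_mul_integral_repKernel_mul_eq_zero hκ hd h]
      simp
    · exact exists_lowDegree_integral_repKernel_mul_prod hκ hd h
  choose! q hq hqe using key
  refine ⟨∑ s ∈ p.support, p.coeff s • q s,
    Submodule.sum_mem _ fun s hs => Submodule.smul_mem _ _ (hq s hs), fun x => ?_⟩
  have e1 : ∀ y, repKernel κ k x y * MvPolynomial.eval y p * Wk κ y =
      ∑ s ∈ p.support, p.coeff s * (repKernel κ k x y * (∏ i, xe y i ^ e s i) * Wk κ y) := by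
    intro y
    rw [eval_eq_sum_prod_xe, mul_sum, sum_mul]
    exact sum_congr rfl fun s _ => by ring
  simp only [e1]
  rw [integral_finsetSum _ fun s _ => (integrableOn_mul_Wk hκ (by fun_prop)).const_mul _, mul_sum,
    eval_eq_sum_prod_xe p x, map_sum, ← sum_add_distrib]
  refine sum_congr rfl fun s hs => ?_
  rw [integral_const_mul, mul_left_comm, hqe s hs, MvPolynomial.smul_eval]
  ring

lemma inVn_repKernelPoly (hκ : ∀ i, 0 ≤ κ i) (hd : 0 < d) (k : ℕ) (y : Fin d → ℝ) :
    InVn d k κ (repKernelPoly κ k y) := by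
  refine ⟨totalDegree_repKernelPoly_le κ k y, fun g hg => ?_⟩
  have e1 : ∀ x, repKernel κ k x y * MvPolynomial.eval x g * Wk κ x =
      ∑ s ∈ g.support, g.coeff s * (repKernel κ k y x *
        (∏ i, xe x i ^ (Fin.snoc (α := fun _ => ℕ) (fun i => s i) 0 : Fin (d + 1) → ℕ) i) *
          Wk κ x) := by
    intro x
    rw [eval_eq_sum_prod_xe, mul_sum, sum_mul, repKernel_comm]
    exact sum_congr rfl fun s _ => by ring
  simp only [ipk, eval_repKernelPoly, e1]
  rw [integral_finsetSum _ fun s _ => (integrableOn_mul_Wk hκ (by fun_prop)).const_mul _, mul_sum]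
  refine sum_eq_zero fun s hs => ?_
  rw [integral_const_mul, mul_left_comm,
    bk_mul_integral_repKernel_mul_eq_zero hκ hd ((sum_snoc_le g hs).trans_lt hg), mul_zero]

lemma integrableOn_eval_mul_eval_mul_Wk (hκ : ∀ i, 0 ≤ κ i) (p q : MvPolynomial (Fin d) ℝ) :
    IntegrableOn (fun x => MvPolynomial.eval x p * MvPolynomial.eval x q * Wk κ x) (Splx d) :=
  integrableOn_mul_Wk hκ (f := fun x => MvPolynomial.eval x p * MvPolynomial.eval x q)
    ((MvPolynomial.continuous_eval p).mul (MvPolynomial.continuous_eval q))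

lemma ipk_eq_zero_of_mem_lowDegree (hκ : ∀ i, 0 ≤ κ i) {k : ℕ} {p q : MvPolynomial (Fin d) ℝ}
    (hp : InVn d k κ p) (hq : q ∈ lowDegree d k) :
    ipk κ (fun x => MvPolynomial.eval x p) (fun x => MvPolynomial.eval x q) = 0 := by
  induction hq using Submodule.span_induction with
  | mem q hq =>
    obtain ⟨γ, hγ, rfl⟩ := hq
    exact hp.2 _ ((totalDegree_prod_xePoly_pow_le γ).trans_lt hγ)
  | zero => simp [ipk]
  | add q r _ _ hq hr =>
    simp only [ipk, map_add, mul_add, add_mul] at hq hr ⊢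
    rw [integral_add (integrableOn_eval_mul_eval_mul_Wk hκ p q)
      (integrableOn_eval_mul_eval_mul_Wk hκ p r), mul_add, hq, hr, add_zero]
  | smul c q _ hq =>
    simp only [ipk, MvPolynomial.smul_eval] at hq ⊢
    have : ∀ x, MvPolynomial.eval x p * (c * MvPolynomial.eval x q) * Wk κ x =
      c * (MvPolynomial.eval x p * MvPolynomial.eval x q * Wk κ x) := fun x => by ring
    simp only [this]
    rw [integral_const_mul, mul_left_comm, hq, mul_zero]

lemma xe_pos_of_mem_interior (hd : 0 < d) {x : Fin d → ℝ} (hx : x ∈ interior (Splx d))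
    (k : Fin (d + 1)) : 0 < xe x k := by
  obtain ⟨v, hv⟩ : ∃ v : Fin d → ℝ, ∀ t : ℝ, xe (x + t • v) k = xe x k - t := by
    refine Fin.lastCases ⟨Pi.single ⟨0, hd⟩ 1, fun t => ?_⟩
      (fun i => ⟨Pi.single i (-1), fun t => ?_⟩) k
    · simp [sum_add_distrib, ← mul_sum, sub_sub]
    · simp; ring
  have hcont : Filter.Tendsto (fun t : ℝ => x + t • v) (nhds 0) (nhds x) := by
    have : Continuous fun t : ℝ => x + t • v := by fun_prop
    simpa using this.tendsto 0
  obtain ⟨ε, hε, h⟩ := Metric.eventually_nhds_iff.mp (hcont (mem_interior_iff_mem_nhds.mp hx))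
  have h1 := h (y := ε / 2) (by rw [Real.dist_eq, sub_zero, abs_of_pos (by linarith)]; linarith)
  have h2 := mem_Splx_iff.mp h1 k
  rw [hv] at h2
  linarith

lemma eval_eq_zero_of_ipk_self_eq_zero (hκ : ∀ i, 0 ≤ κ i) (hd : 0 < d)
    {q : MvPolynomial (Fin d) ℝ}
    (hq : ipk κ (fun x => MvPolynomial.eval x q) (fun x => MvPolynomial.eval x q) = 0)
    {x : Fin d → ℝ} (hx : x ∈ interior (Splx d)) : MvPolynomial.eval x q = 0 := by
  have hc : Continuous fun x => MvPolynomial.eval x q := MvPolynomial.continuous_eval q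
  have h1 := (mul_eq_zero.mp hq).resolve_left (bk_pos hκ).ne'
  rw [setIntegral_eq_zero_iff_of_nonneg_ae _ (integrableOn_eval_mul_eval_mul_Wk hκ q q)] at h1
  · have h2 := ae_restrict_of_ae_restrict_of_subset (interior_subset (s := Splx d)) h1
    have h3 := Measure.eqOn_open_of_ae_eq h2 isOpen_interior
      ((hc.mul hc).mul (continuous_Wk hκ)).continuousOn continuousOn_const hx
    have h4 : Wk κ x ≠ 0 := by
      rw [Wk_eq_prod_xe]
      exact (prod_pos fun k _ => Real.rpow_pos_of_pos (xe_pos_of_mem_interior hd hx k) _).ne'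
    simpa [h4] using h3
  · exact (ae_restrict_iff' measurableSet_Splx).mpr
      (Filter.Eventually.of_forall fun x hx => mul_nonneg (mul_self_nonneg _) (Wk_nonneg κ hx))

/-- The reproducing kernels are given by the explicit formula in the interior of the simplex. -/
lemma IsRK.eq_repKernel (hκ : ∀ i, 0 ≤ κ i) (hd : 0 < d)
    {P : ℕ → (Fin d → ℝ) → (Fin d → ℝ) → ℝ} (hP : IsRK d κ P) (k : ℕ) {x : Fin d → ℝ}
    (hx : x ∈ interior (Splx d)) (y : Fin d → ℝ) : P k x y = repKernel κ k x y := by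
  obtain ⟨hsymm, hV, hrep⟩ := hP k
  obtain ⟨p, hp, hpe⟩ := hV y
  obtain ⟨q, hq, hqe⟩ := exists_lowDegree_integral_repKernel_mul hκ hd hp.1
  have hqe' : ∀ z, MvPolynomial.eval z q = repKernel κ k z y - P k z y := by
    intro z
    have h1 := hrep _ (inVn_repKernelPoly hκ hd k z) y
    have h2 := hqe z
    rw [eval_repKernelPoly] at h1
    have h3 : ∀ w, P k y w * MvPolynomial.eval w (repKernelPoly κ k z) * Wk κ w =
        repKernel κ k z w * MvPolynomial.eval w p * Wk κ w := by
      intro w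
      rw [eval_repKernelPoly, hsymm y w, hpe w, repKernel_comm κ k w z]
      ring
    simp only [h3] at h1
    rw [h1, ← hpe z, repKernel_comm] at h2
    linarith
  have hdiff : ∀ z, MvPolynomial.eval z q = MvPolynomial.eval z (repKernelPoly κ k y) -
      MvPolynomial.eval z p := fun z => by rw [hqe', eval_repKernelPoly, hpe]
  have h0 : ipk κ (fun x => MvPolynomial.eval x q) (fun x => MvPolynomial.eval x q) = 0 := by
    have h1 := ipk_eq_zero_of_mem_lowDegree hκ (inVn_repKernelPoly hκ hd k y) hq
    have h2 := ipk_eq_zero_of_mem_lowDegree hκ hp hq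
    simp only [ipk] at h1 h2 ⊢
    have e : ∀ z, MvPolynomial.eval z q * MvPolynomial.eval z q * Wk κ z =
        MvPolynomial.eval z (repKernelPoly κ k y) * MvPolynomial.eval z q * Wk κ z -
          MvPolynomial.eval z p * MvPolynomial.eval z q * Wk κ z := fun z => by
      nth_rewrite 1 [hdiff]
      ring
    simp only [e]
    rw [integral_sub (integrableOn_eval_mul_eval_mul_Wk hκ _ q)
      (integrableOn_eval_mul_eval_mul_Wk hκ p q), mul_sub, h1, h2, sub_zero]
  have h1 := eval_eq_zero_of_ipk_self_eq_zero hκ hd h0 hx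
  rw [hqe'] at h1
  linarith

end Kernel

/-- The probability measure on `[-1, 1]` with density proportional to `(1 - t ^ 2) ^ (c - 1 / 2)`,
realized as the push-forward under `cos` of the normalized density `sin θ ^ (2 * c)` on
`[0, π]`. -/
def arcMeasure (c : ℝ) : Measure ℝ :=
  ((volume.restrict (Set.Ioc 0 Real.pi)).withDensity fun θ =>
    ENNReal.ofReal (Real.sin θ ^ (2 * c) / ∫ θ in 0..Real.pi, Real.sin θ ^ (2 * c))).map Real.cos

section ArcMeasure

variable {c : ℝ}

lemma continuous_sin_rpow (hc : 0 ≤ c) : Continuous fun θ : ℝ => Real.sin θ ^ (2 * c) :=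
  Real.continuous_sin.rpow_const fun _ => Or.inr (by positivity)

lemma integral_sin_rpow_pos (hc : 0 ≤ c) : 0 < ∫ θ in 0..Real.pi, Real.sin θ ^ (2 * c) :=
  intervalIntegral.intervalIntegral_pos_of_pos_on
    ((continuous_sin_rpow hc).intervalIntegrable _ _)
    (fun _ hθ => Real.rpow_pos_of_pos (Real.sin_pos_of_mem_Ioo hθ) _) Real.pi_pos

lemma integral_arcMeasure (hc : 0 ≤ c) {f : ℝ → ℝ} (hf : AEStronglyMeasurable f (arcMeasure c)) :
    ∫ t, f t ∂arcMeasure c =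
      (∫ θ in 0..Real.pi, f (Real.cos θ) * Real.sin θ ^ (2 * c)) /
        ∫ θ in 0..Real.pi, Real.sin θ ^ (2 * c) := by
  have hZ := integral_sin_rpow_pos hc
  rw [arcMeasure] at hf ⊢
  generalize (∫ θ in 0..Real.pi, Real.sin θ ^ (2 * c)) = Z at *
  rw [integral_map Real.continuous_cos.aemeasurable hf,
    integral_withDensity_eq_integral_toReal_smul
      ((continuous_sin_rpow hc).div_const _).measurable.ennreal_ofReal
      (Filter.Eventually.of_forall fun _ => ENNReal.ofReal_lt_top),
    ← intervalIntegral.integral_div, intervalIntegral.integral_of_le Real.pi_pos.le]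
  apply setIntegral_congr_fun measurableSet_Ioc
  intro θ hθ
  have : 0 ≤ Real.sin θ := Real.sin_nonneg_of_nonneg_of_le_pi hθ.1.le hθ.2
  simp only [smul_eq_mul]
  rw [ENNReal.toReal_ofReal (by positivity)]
  ring

lemma isProbabilityMeasure_arcMeasure (hc : 0 ≤ c) : IsProbabilityMeasure (arcMeasure c) := by
  have hZ := integral_sin_rpow_pos hc
  have hcont := (continuous_sin_rpow hc).div_const (∫ θ in 0..Real.pi, Real.sin θ ^ (2 * c))
  refine ⟨?_⟩
  rw [arcMeasure, Measure.map_apply Real.measurable_cos MeasurableSet.univ, Set.preimage_univ,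
    withDensity_apply _ MeasurableSet.univ, Measure.restrict_univ,
    ← ofReal_integral_eq_lintegral_ofReal]
  · rw [← intervalIntegral.integral_of_le Real.pi_pos.le, intervalIntegral.integral_div,
      div_self hZ.ne', ENNReal.ofReal_one]
  · exact (hcont.intervalIntegrable _ _).1
  · refine (ae_restrict_iff' measurableSet_Ioc).mpr (Filter.Eventually.of_forall fun θ hθ => ?_)
    have : 0 ≤ Real.sin θ := Real.sin_nonneg_of_nonneg_of_le_pi hθ.1.le hθ.2
    simp only [Pi.zero_apply]
    positivity

lemma ae_abs_le_one_arcMeasure (c : ℝ) : ∀ᵐ t ∂arcMeasure c, |t| ≤ 1 := by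
  rw [arcMeasure, ae_map_iff Real.continuous_cos.aemeasurable
    (measurableSet_le (by fun_prop) measurable_const)]
  exact Filter.Eventually.of_forall Real.abs_cos_le_one

lemma hasDerivAt_sin_rpow (hc : 0 ≤ c) (θ : ℝ) :
    HasDerivAt (fun θ => Real.sin θ ^ (2 * c + 1))
      (Real.cos θ * ((2 * c + 1) * Real.sin θ ^ (2 * c))) θ := by
  have := (Real.hasDerivAt_sin θ).rpow_const (p := 2 * c + 1) (Or.inr (by linarith))
  convert this using 1
  rw [add_sub_cancel_right]
  ring

lemma integral_cos_mul_sin_rpow (hc : 0 ≤ c) :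
    ∫ θ in 0..Real.pi, Real.cos θ * Real.sin θ ^ (2 * c) = 0 := by
  have h := intervalIntegral.integral_eq_sub_of_hasDerivAt (a := 0) (b := Real.pi)
    (fun θ _ => hasDerivAt_sin_rpow hc θ)
    ((by have := continuous_sin_rpow hc; fun_prop : Continuous fun θ =>
      Real.cos θ * ((2 * c + 1) * Real.sin θ ^ (2 * c))).intervalIntegrable _ _)
  rw [Real.sin_pi, Real.sin_zero, sub_self] at h
  simp only [mul_left_comm (Real.cos _)] at h
  rw [intervalIntegral.integral_const_mul] at h
  exact (mul_eq_zero.mp h).resolve_left (by positivity)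

lemma integral_cos_pow_mul_sin_rpow (hc : 0 ≤ c) (k : ℕ) :
    (2 * c + k + 2) * ∫ θ in 0..Real.pi, Real.cos θ ^ (k + 2) * Real.sin θ ^ (2 * c) =
      (k + 1) * ∫ θ in 0..Real.pi, Real.cos θ ^ k * Real.sin θ ^ (2 * c) := by
  have hs := continuous_sin_rpow hc
  have hs' : Continuous fun θ : ℝ => Real.sin θ ^ (2 * c + 1) :=
    Real.continuous_sin.rpow_const fun _ => Or.inr (by positivity)
  have h := intervalIntegral.integral_eq_sub_of_hasDerivAt (a := 0) (b := Real.pi)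
    (fun θ _ => ((Real.hasDerivAt_cos θ).pow (k + 1)).mul (hasDerivAt_sin_rpow hc θ))
    (Continuous.intervalIntegrable (by fun_prop) _ _)
  have h0 : (0 : ℝ) ^ (2 * c + 1) = 0 := Real.zero_rpow (by positivity)
  simp only [Pi.mul_apply, Real.sin_pi, Real.sin_zero, h0, mul_zero, sub_zero] at h
  rw [← sub_eq_zero]
  refine Eq.trans ?_ h
  rw [← intervalIntegral.integral_const_mul,
    ← intervalIntegral.integral_const_mul, ← intervalIntegral.integral_sub
      (Continuous.intervalIntegrable (by fun_prop) _ _)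
      (Continuous.intervalIntegrable (by fun_prop) _ _)]
  apply intervalIntegral.integral_congr
  intro θ hθ
  rw [Set.uIcc_of_le Real.pi_pos.le] at hθ
  have hsin : 0 ≤ Real.sin θ := Real.sin_nonneg_of_nonneg_of_le_pi hθ.1 hθ.2
  simp only [Pi.pow_apply]
  rw [Real.rpow_add_one' hsin (by positivity), add_tsub_cancel_right]
  push_cast
  linear_combination ((k + 1) * Real.cos θ ^ k * Real.sin θ ^ (2 * c)) * Real.sin_sq_add_cos_sq θ

lemma integral_pow_arcMeasure (hc : 0 ≤ c) (k : ℕ) :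
    (2 * c + k + 2) * ∫ t, t ^ (k + 2) ∂arcMeasure c = (k + 1) * ∫ t, t ^ k ∂arcMeasure c := by
  rw [integral_arcMeasure hc (by fun_prop), integral_arcMeasure hc (by fun_prop), mul_div_assoc',
    integral_cos_pow_mul_sin_rpow hc, mul_div_assoc]

lemma integral_odd_pow_arcMeasure (hc : 0 ≤ c) (k : ℕ) :
    ∫ t, t ^ (2 * k + 1) ∂arcMeasure c = 0 := by
  induction k with
  | zero =>
    rw [integral_arcMeasure hc (by fun_prop)]
    simp [integral_cos_mul_sin_rpow hc]
  | succ k ih =>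
    have h := integral_pow_arcMeasure hc (2 * k + 1)
    rw [ih, mul_zero] at h
    exact (mul_eq_zero.mp h).resolve_left (by positivity)

lemma integral_even_pow_arcMeasure (hc : 0 ≤ c) (k : ℕ) :
    ∫ t, t ^ (2 * k) ∂arcMeasure c = (2 * k)! / (4 ^ k * k ! * rf (c + 1) k) := by
  induction k with
  | zero =>
    have := isProbabilityMeasure_arcMeasure hc
    simp [rf_zero]
  | succ k ih =>
    have h := integral_pow_arcMeasure hc (2 * k)
    rw [ih] at h
    have hr : 0 < rf (c + 1) k := rf_pos (by positivity) k
    have h1 : (2 * c + (2 * k : ℕ) + 2 : ℝ) ≠ 0 := by positivity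
    have h2 : (c + 1 + k : ℝ) ≠ 0 := by positivity
    rw [show 2 * (k + 1) = 2 * k + 2 by ring, ← mul_right_inj' h1, h, rf_succ, Nat.factorial_succ,
      Nat.factorial_succ, Nat.factorial_succ]
    push_cast
    field_simp
    ring

lemma integral_inv_one_add_mul_sq_le {b : ℝ} (hb : 0 < b) :
    ∫ θ in 0..Real.pi, (1 + b * θ ^ 2)⁻¹ ≤ Real.pi / 2 * b ^ (-(1 / 2) : ℝ) := by
  have hs : 0 < √b := Real.sqrt_pos.mpr hb
  have h : ∫ θ in 0..Real.pi, (1 + b * θ ^ 2)⁻¹ = ∫ θ in 0..Real.pi, (1 + (√b * θ) ^ 2)⁻¹ := by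
    refine intervalIntegral.integral_congr fun θ _ => ?_
    simp only [mul_pow, Real.sq_sqrt hb.le]
  rw [h, intervalIntegral.integral_comp_mul_left (fun x => (1 + x ^ 2)⁻¹) hs.ne',
    integral_inv_one_add_sq, mul_zero, Real.arctan_zero, sub_zero, smul_eq_mul,
    Real.rpow_neg hb.le, ← Real.sqrt_eq_rpow, mul_comm]
  gcongr
  exact (Real.arctan_lt_pi_div_two _).le

lemma one_add_mul_one_sub_cos_ge {B θ : ℝ} (hB : 0 ≤ B) (h0 : 0 ≤ θ) (hθ : θ ≤ Real.pi) :
    (1 + (1 + B) * θ ^ 2) / 11 ≤ 1 + B * (1 - Real.cos θ) := by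
  have h1 := Real.cos_le_one_sub_mul_cos_sq (by rwa [abs_of_nonneg h0] : |θ| ≤ Real.pi)
  have hpi : Real.pi ^ 2 ≤ 10 := by nlinarith [Real.pi_lt_d2, Real.pi_pos]
  have h2 : 2 / 10 * θ ^ 2 ≤ 2 / Real.pi ^ 2 * θ ^ 2 := by
    gcongr
  have h3 : θ ^ 2 ≤ 10 := le_trans (by gcongr) hpi
  have h4 : B * (2 / 10 * θ ^ 2) ≤ B * (1 - Real.cos θ) := by gcongr; linarith
  nlinarith [mul_nonneg hB (sq_nonneg θ)]

lemma exists_integral_arcMeasure_tail_le (hc : 0 ≤ c) :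
    ∃ C, 0 ≤ C ∧ ∀ B, 0 ≤ B →
      ∫ t, (1 + B * |1 - t|) ^ (-(c + 1)) ∂arcMeasure c ≤ C * (1 + B) ^ (-(c + 1 / 2)) := by
  have hZ := integral_sin_rpow_pos hc
  refine ⟨11 ^ (c + 1) * (Real.pi / 2) / ∫ θ in 0..Real.pi, Real.sin θ ^ (2 * c),
    by positivity, fun B hB => ?_⟩
  have hb : 0 < 1 + B := by positivity
  have hpos : ∀ θ, 0 < 1 + B * (1 - Real.cos θ) := fun θ => by
    have := mul_nonneg hB (sub_nonneg.mpr (Real.cos_le_one θ))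
    linarith
  have key : ∀ θ ∈ Set.Icc 0 Real.pi,
      (1 + B * (1 - Real.cos θ)) ^ (-(c + 1)) * Real.sin θ ^ (2 * c) ≤
        11 ^ (c + 1) * (1 + B) ^ (-c) * (1 + (1 + B) * θ ^ 2)⁻¹ := by
    rintro θ ⟨h0, hθ⟩
    have hsin : 0 ≤ Real.sin θ := Real.sin_nonneg_of_nonneg_of_le_pi h0 hθ
    set q := 1 + (1 + B) * θ ^ 2 with hq
    have hq0 : 0 < q := by positivity
    have e1 : (1 + B * (1 - Real.cos θ)) ^ (-(c + 1)) ≤ 11 ^ (c + 1) * q ^ (-(c + 1)) := by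
      calc (1 + B * (1 - Real.cos θ)) ^ (-(c + 1)) ≤ (q / 11) ^ (-(c + 1)) :=
            Real.rpow_le_rpow_of_nonpos (by positivity) (one_add_mul_one_sub_cos_ge hB h0 hθ)
              (by linarith)
        _ = _ := by
            rw [Real.div_rpow hq0.le (by norm_num), Real.rpow_neg (by norm_num : (0 : ℝ) ≤ 11),
              div_inv_eq_mul, mul_comm]
    have e2 : Real.sin θ ^ (2 * c) ≤ (1 + B) ^ (-c) * q ^ c := by
      calc Real.sin θ ^ (2 * c) ≤ θ ^ (2 * c) :=
            Real.rpow_le_rpow hsin (Real.sin_le h0) (by positivity)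
        _ = (θ ^ 2) ^ c := by
            rw [Real.rpow_mul h0, Real.rpow_two]
        _ ≤ (q / (1 + B)) ^ c := by
            refine Real.rpow_le_rpow (by positivity) ?_ hc
            rw [le_div_iff₀ hb]
            linarith
        _ = _ := by
            rw [Real.div_rpow hq0.le hb.le, Real.rpow_neg hb.le, div_eq_mul_inv, mul_comm]
    calc _ ≤ (11 ^ (c + 1) * q ^ (-(c + 1))) * ((1 + B) ^ (-c) * q ^ c) :=
          mul_le_mul e1 e2 (by positivity) (by positivity)
      _ = 11 ^ (c + 1) * (1 + B) ^ (-c) * (q ^ (-(c + 1)) * q ^ c) := by ring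
      _ = _ := by
          rw [← Real.rpow_add hq0, show -(c + 1) + c = -1 by ring, Real.rpow_neg_one]
  have hs := continuous_sin_rpow hc
  have hcont1 : Continuous fun θ : ℝ => (1 + B * (1 - Real.cos θ)) ^ (-(c + 1)) :=
    Continuous.rpow_const (by fun_prop) fun θ => Or.inl (hpos θ).ne'
  have hcont2 : Continuous fun θ : ℝ => (1 + (1 + B) * θ ^ 2)⁻¹ :=
    Continuous.inv₀ (by fun_prop) fun θ => by positivity
  have habs : ∀ θ, |1 - Real.cos θ| = 1 - Real.cos θ := fun θ =>
    abs_of_nonneg (sub_nonneg.mpr (Real.cos_le_one θ))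
  rw [integral_arcMeasure hc (Measurable.aestronglyMeasurable (by fun_prop)),
    div_mul_eq_mul_div, div_le_div_iff_of_pos_right hZ]
  simp only [habs]
  calc _ ≤ ∫ θ in 0..Real.pi, 11 ^ (c + 1) * (1 + B) ^ (-c) * (1 + (1 + B) * θ ^ 2)⁻¹ :=
        intervalIntegral.integral_mono_on Real.pi_pos.le
          (Continuous.intervalIntegrable (by fun_prop) _ _)
          (Continuous.intervalIntegrable (by fun_prop) _ _) key
    _ ≤ 11 ^ (c + 1) * (1 + B) ^ (-c) * (Real.pi / 2 * (1 + B) ^ (-(1 / 2) : ℝ)) := by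
        rw [intervalIntegral.integral_const_mul]
        gcongr
        exact integral_inv_one_add_mul_sq_le hb
    _ = 11 ^ (c + 1) * (Real.pi / 2) * ((1 + B) ^ (-c) * (1 + B) ^ (-(1 / 2) : ℝ)) := by ring
    _ = _ := by
        rw [← Real.rpow_add hb, show -c + -(1 / 2) = -(c + 1 / 2) by ring]

end ArcMeasure

section Intertwining

variable {d : ℕ} {κ : Fin (d + 1) → ℝ}

/-- The product of the arc measures with parameters `κ i`. -/
def arcProd (κ : Fin (d + 1) → ℝ) : Measure (Fin (d + 1) → ℝ) :=
  Measure.pi fun i => arcMeasure (κ i)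

/-- The linear form `∑ i, √x_i * √y_i * t_i`. -/
def sqrtForm (x y : Fin d → ℝ) (t : Fin (d + 1) → ℝ) : ℝ :=
  ∑ i, √(xe x i) * √(xe y i) * t i

@[fun_prop]
lemma continuous_sqrtForm (x y : Fin d → ℝ) : Continuous (sqrtForm x y) := by
  unfold sqrtForm
  fun_prop

lemma isProbabilityMeasure_arcProd (hκ : ∀ i, 0 ≤ κ i) : IsProbabilityMeasure (arcProd κ) := by
  have := fun i => isProbabilityMeasure_arcMeasure (hκ i)
  unfold arcProd
  infer_instance

lemma ae_forall_abs_le_one_arcProd (hκ : ∀ i, 0 ≤ κ i) : ∀ᵐ t ∂arcProd κ, ∀ i, |t i| ≤ 1 := by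
  have := fun i => isProbabilityMeasure_arcMeasure (hκ i)
  refine Filter.eventually_all.mpr fun i => ?_
  exact (Measure.tendsto_eval_ae_ae (μ := fun i => arcMeasure (κ i)) (i := i)).eventually
    (ae_abs_le_one_arcMeasure (κ i))

lemma integrable_arcProd (hκ : ∀ i, 0 ≤ κ i) {f : (Fin (d + 1) → ℝ) → ℝ} (hf : Continuous f) :
    Integrable f (arcProd κ) := by
  have := isProbabilityMeasure_arcProd hκ
  have h : (arcProd κ).restrict (Set.Icc (-1) 1) = arcProd κ := by
    refine Measure.restrict_eq_self_of_ae_mem ?_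
    filter_upwards [ae_forall_abs_le_one_arcProd hκ] with t ht
    exact ⟨fun i => (abs_le.mp (ht i)).1, fun i => (abs_le.mp (ht i)).2⟩
  rw [← h]
  exact hf.continuousOn.integrableOn_compact isCompact_Icc

lemma integral_arcProd_prod (hκ : ∀ i, 0 ≤ κ i) (f : Fin (d + 1) → ℝ → ℝ) :
    ∫ t, ∏ i, f i (t i) ∂arcProd κ = ∏ i, ∫ s, f i s ∂arcMeasure (κ i) := by
  have := fun i => isProbabilityMeasure_arcMeasure (hκ i)
  exact integral_fintype_prod_eq_prod f

lemma integral_sqrtForm_pow (hκ : ∀ i, 0 ≤ κ i) (x y : Fin d → ℝ) (m : ℕ) :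
    ∫ t, sqrtForm x y t ^ m ∂arcProd κ = ∑ β ∈ piAntidiag (univ : Finset (Fin (d + 1))) m,
      Nat.multinomial univ β *
        ∏ i, (√(xe x i) * √(xe y i)) ^ β i * ∫ s, s ^ β i ∂arcMeasure (κ i) := by
  simp only [sqrtForm, sum_pow_eq_sum_piAntidiag]
  rw [integral_finsetSum _ fun β _ => integrable_arcProd hκ (by fun_prop)]
  refine sum_congr rfl fun β _ => ?_
  rw [integral_const_mul]
  simp only [mul_pow _ (_ : ℝ) (β _)]
  rw [integral_arcProd_prod hκ fun i s => (√(xe x i) ^ β i * √(xe y i) ^ β i) * s ^ β i]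
  simp only [integral_const_mul]

lemma integral_sqrtForm_odd_pow (hκ : ∀ i, 0 ≤ κ i) (x y : Fin d → ℝ) (m : ℕ) :
    ∫ t, sqrtForm x y t ^ (2 * m + 1) ∂arcProd κ = 0 := by
  rw [integral_sqrtForm_pow hκ]
  refine sum_eq_zero fun β hβ => ?_
  obtain ⟨i, hi⟩ : ∃ i, Odd (β i) := by
    by_contra! h
    have h1 : Even (∑ i, β i) := even_sum _ fun i _ => by simpa using h i
    rw [(mem_piAntidiag.mp hβ).1] at h1
    exact absurd h1 (by simp)
  obtain ⟨k, hk⟩ := hi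
  rw [prod_eq_zero (mem_univ i), mul_zero]
  rw [hk, integral_odd_pow_arcMeasure (hκ i), mul_zero]

lemma mem_map_two_nsmul_piAntidiag {ι : Type*} [Fintype ι] [DecidableEq ι] {m : ℕ} {β : ι → ℕ} :
    β ∈ (piAntidiag univ m).map ⟨(2 • ·), nsmul_right_injective two_ne_zero⟩ ↔
      β ∈ piAntidiag univ (2 * m) ∧ ∀ i, 2 ∣ β i := by
  rw [map_nsmul_piAntidiag_univ m two_ne_zero, mem_filter]

lemma integral_sqrtForm_even_pow (hκ : ∀ i, 0 ≤ κ i) {x y : Fin d → ℝ} (hx : x ∈ Splx d)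
    (hy : y ∈ Splx d) (m : ℕ) :
    ∫ t, sqrtForm x y t ^ (2 * m) ∂arcProd κ = (2 * m)! / 4 ^ m * homKernel κ m x y := by
  rw [integral_sqrtForm_pow hκ, homKernel, mul_sum,
    ← sum_subset (s₁ := (piAntidiag univ m).map ⟨(2 • ·), nsmul_right_injective two_ne_zero⟩),
    sum_map]
  · refine sum_congr rfl fun α hα => ?_
    have hs : ∑ i, α i = m := (mem_piAntidiag.mp hα).1
    have h1 := Nat.multinomial_spec univ fun i => 2 * α i
    rw [← mul_sum, hs] at h1
    have h2 : (Nat.multinomial univ fun i => 2 * α i : ℝ) =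
        (2 * m)! * ∏ i, (1 / ((2 * α i)! : ℝ)) := by
      rw [← h1]
      push_cast
      rw [prod_div_distrib, prod_const_one]
      field_simp
    have h3 : (1 / 4 ^ m : ℝ) = ∏ i, 1 / 4 ^ α i := by
      rw [prod_div_distrib, prod_const_one, prod_pow_eq_pow_sum, hs]
    simp only [Function.Embedding.coeFn_mk, Pi.smul_def, smul_eq_mul]
    rw [h2, div_eq_mul_one_div _ ((4 : ℝ) ^ m), h3, mul_assoc, mul_assoc, ← prod_mul_distrib,
      ← prod_mul_distrib]
    congr 1
    refine prod_congr rfl fun i _ => ?_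
    rw [integral_even_pow_arcMeasure (hκ i), pow_mul, mul_pow, Real.sq_sqrt (mem_Splx_iff.mp hx i),
      Real.sq_sqrt (mem_Splx_iff.mp hy i)]
    have := rf_pos (by linarith [hκ i] : 0 < κ i + 1) (α i)
    field_simp
  · exact fun β hβ => (mem_map_two_nsmul_piAntidiag.mp hβ).1
  · intro β hβ hβ'
    rw [mem_map_two_nsmul_piAntidiag, not_and, not_forall] at hβ'
    obtain ⟨i, hi⟩ := hβ' hβ
    obtain ⟨k, hk⟩ : ∃ k, β i = 2 * k + 1 := ⟨β i / 2, by omega⟩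
    rw [prod_eq_zero (mem_univ i), mul_zero]
    rw [hk, integral_odd_pow_arcMeasure (hκ i), mul_zero]

lemma sum_range_two_mul_add_one {f : ℕ → ℝ} (hf : ∀ j, f (2 * j + 1) = 0) (N : ℕ) :
    ∑ k ∈ range (2 * N + 1), f k = ∑ j ∈ range (N + 1), f (2 * j) := by
  induction N with
  | zero => simp
  | succ N ih =>
    rw [show 2 * (N + 1) + 1 = 2 * N + 1 + 1 + 1 by ring, sum_range_succ, sum_range_succ, ih, hf,
      sum_range_succ _ (N + 1)]
    ring_nf

lemma integral_eval_geg (hκ : ∀ i, 0 ≤ κ i) (l : ℝ) (k : ℕ) (x y : Fin d → ℝ) :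
    ∫ t, (geg l k).eval (sqrtForm x y t) ∂arcProd κ =
      ∑ m ∈ range (k + 1), gegCoeff l k m * ∫ t, sqrtForm x y t ^ m ∂arcProd κ := by
  simp only [geg, Polynomial.eval_finsetSum, Polynomial.eval_mul, Polynomial.eval_C,
    Polynomial.eval_pow, Polynomial.eval_X]
  rw [integral_finsetSum _ fun m _ => integrable_arcProd hκ (by fun_prop)]
  simp only [integral_const_mul]

lemma integral_eval_geg_odd (hκ : ∀ i, 0 ≤ κ i) (l : ℝ) (k : ℕ) (x y : Fin d → ℝ) :
    ∫ t, (geg l (2 * k + 1)).eval (sqrtForm x y t) ∂arcProd κ = 0 := by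
  rw [integral_eval_geg hκ]
  refine sum_eq_zero fun m _ => ?_
  obtain ⟨j, rfl | rfl⟩ := Nat.even_or_odd' m
  · rw [gegCoeff_eq_zero _ fun i => by omega, zero_mul]
  · rw [integral_sqrtForm_odd_pow hκ, mul_zero]

lemma integral_eval_geg_even (hκ : ∀ i, 0 ≤ κ i) {x y : Fin d → ℝ} (hx : x ∈ Splx d)
    (hy : y ∈ Splx d) (k : ℕ) :
    (2 * k + ((∑ i, κ i) + d)) / ((∑ i, κ i) + d) *
      ∫ t, (geg ((∑ i, κ i) + d) (2 * k)).eval (sqrtForm x y t) ∂arcProd κ =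
      repKernel κ k x y := by
  rw [integral_eval_geg hκ, sum_range_two_mul_add_one, repKernel, mul_sum]
  · refine sum_congr rfl fun m hm => ?_
    obtain ⟨j, rfl⟩ := Nat.exists_eq_add_of_le (Nat.lt_succ_iff.mp (mem_range.mp hm))
    have h4 : (2 : ℝ) ^ (2 * m) = 4 ^ m := by rw [pow_mul]; norm_num
    rw [integral_sqrtForm_even_pow hκ hx hy, kernelCoeff, mul_add 2 m j, gegCoeff_add,
      add_tsub_cancel_left, h4, show 2 * m + j = m + j + m by ring]
    field_simp
  · intro j
    rw [integral_sqrtForm_odd_pow hκ, mul_zero]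

/-- The univariate polynomial whose image under the intertwining integral is the localized
kernel. -/
def locPoly (l : ℝ) (a : ℝ → ℝ) (n : ℕ) : Polynomial ℝ :=
  ∑ k ∈ range (4 * n + 1), Polynomial.C (a (k / (2 * n)) * ((k + l) / l)) * geg l k

lemma eval_derivative_locPoly {l : ℝ} (hl : 0 < l) (a : ℝ → ℝ) (n : ℕ) (u : ℝ) :
    (locPoly l a n).derivative.eval u = 2 * gegSum (l + 1) a 0 n u := by
  rw [locPoly, sum_range_succ', gegSum, mul_sum]
  simp only [Polynomial.derivative_add, Polynomial.derivative_sum, Polynomial.derivative_C_mul,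
    derivative_geg_zero, derivative_geg_succ, mul_zero, add_zero, Polynomial.eval_finsetSum,
    Polynomial.eval_mul, Polynomial.eval_C, Function.iterate_zero, id_eq, cutSamples]
  refine sum_congr rfl fun k _ => ?_
  rw [extCutoff_of_nonneg a (by positivity)]
  push_cast
  field_simp
  ring

lemma Lk_eq_integral_locPoly (hκ : ∀ i, 0 ≤ κ i) (hd : 0 < d)
    {P : ℕ → (Fin d → ℝ) → (Fin d → ℝ) → ℝ} (hP : IsRK d κ P) {a : ℝ → ℝ} (ha : IsCutoff a)
    {n : ℕ} (hn : 0 < n) {x y : Fin d → ℝ} (hx : x ∈ interior (Splx d)) (hy : y ∈ Splx d) :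
    Lk a P n x y =
      ∫ t, (locPoly ((∑ i, κ i) + d) a n).eval (sqrtForm x y t) ∂arcProd κ := by
  have hn' : (0 : ℝ) < n := by exact_mod_cast hn
  have h1 : Lk a P n x y = ∑ j ∈ range (2 * n + 1), a (j / n) * P j x y := by
    refine tsum_eq_sum fun j hj => ?_
    rw [ha.2.1 _ ?_, zero_mul]
    rw [lt_div_iff₀ hn']
    have : 2 * n < j := by simp at hj; omega
    exact_mod_cast this
  simp only [locPoly, Polynomial.eval_finsetSum, Polynomial.eval_mul, Polynomial.eval_C]
  rw [h1, integral_finsetSum _ fun k _ => integrable_arcProd hκ (by fun_prop)]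
  simp only [integral_const_mul]
  rw [show 4 * n = 2 * (2 * n) by ring, sum_range_two_mul_add_one (f := fun k =>
    a (k / (2 * n)) * ((k + ((∑ i, κ i) + d)) / ((∑ i, κ i) + d)) *
      ∫ t, (geg ((∑ i, κ i) + d) k).eval (sqrtForm x y t) ∂arcProd κ)]
  · refine sum_congr rfl fun j _ => ?_
    rw [hP.eq_repKernel hκ hd j hx y, ← integral_eval_geg_even hκ (interior_subset hx) hy,
      mul_assoc]
    push_cast
    rw [mul_div_mul_left _ _ two_ne_zero]
  · intro j
    rw [integral_eval_geg_odd hκ, mul_zero]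

end Intertwining

section Derivative

variable {d : ℕ} {κ : Fin (d + 1) → ℝ}

lemma pdE_eq_fderiv (k : Fin (d + 1)) (f : (Fin d → ℝ) → ℝ) (x : Fin d → ℝ) :
    pdE k f x = fderiv ℝ f x fun l => if l.castSucc = k then 1 else 0 := by
  refine Fin.lastCases ?_ (fun i => ?_) k
  · have h : (fun l : Fin d => if l.castSucc = Fin.last d then (1 : ℝ) else 0) = 0 := by
      ext l
      simp [(Fin.castSucc_lt_last l).ne]
    rw [h, map_zero]
    simp [pdE]
  · have h : (fun l : Fin d => if l.castSucc = i.castSucc then (1 : ℝ) else 0) = Pi.single i 1 := by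
      ext l
      simp [Pi.single_apply]
    rw [h]
    simp [pdE, pd]

/-- The difference of the indicator functions of `i` and `j`. -/
def diffInd (i j k : Fin (d + 1)) : ℝ := (if k = i then 1 else 0) - if k = j then 1 else 0

lemma pdE_sub_pdE_eq_fderiv (i j : Fin (d + 1)) (f : (Fin d → ℝ) → ℝ) (x : Fin d → ℝ) :
    pdE i f x - pdE j f x = fderiv ℝ f x fun l => diffInd i j l.castSucc := by
  rw [pdE_eq_fderiv, pdE_eq_fderiv, ← map_sub]
  rfl

lemma xe_add_smul_diffInd (i j : Fin (d + 1)) (x : Fin d → ℝ) (s : ℝ) (k : Fin (d + 1)) :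
    xe (x + s • fun l => diffInd i j l.castSucc) k = xe x k + s * diffInd i j k := by
  have h : ∑ k : Fin (d + 1), diffInd i j k = 0 := by simp [diffInd]
  rw [Fin.sum_univ_castSucc] at h
  refine Fin.lastCases ?_ (fun l => ?_) k
  · simp only [xe_last, Pi.add_apply, Pi.smul_apply, smul_eq_mul, sum_add_distrib, ← mul_sum]
    linear_combination -s * h
  · simp

lemma differentiable_eval (p : MvPolynomial (Fin d) ℝ) :
    Differentiable ℝ fun x : Fin d → ℝ => MvPolynomial.eval x p := by
  induction p using MvPolynomial.induction_on with
  | C a => simp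
  | add p q hp hq => simpa using hp.fun_add hq
  | mul_X p i hp => simpa using hp.fun_mul (differentiable_apply i)

lemma IsRK.differentiable_Lk {P : ℕ → (Fin d → ℝ) → (Fin d → ℝ) → ℝ} (hP : IsRK d κ P)
    {a : ℝ → ℝ} (ha : IsCutoff a) {n : ℕ} (hn : 0 < n) (y : Fin d → ℝ) :
    Differentiable ℝ fun x => Lk a P n x y := by
  have hn' : (0 : ℝ) < n := by exact_mod_cast hn
  have h1 : (fun x => Lk a P n x y) =
      fun x => ∑ j ∈ range (2 * n + 1), a (j / n) * P j x y := by
    ext x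
    refine tsum_eq_sum fun j hj => ?_
    rw [ha.2.1 _ ?_, zero_mul]
    rw [lt_div_iff₀ hn']
    have : 2 * n < j := by simp at hj; omega
    exact_mod_cast this
  rw [h1]
  refine Differentiable.fun_sum fun j _ => ?_
  obtain ⟨p, -, hp⟩ := (hP j).2.1 y
  simp only [hp]
  exact (differentiable_eval p).const_mul _

lemma hasDerivAt_integral_eval_sqrtForm (hκ : ∀ i, 0 ≤ κ i) (p : Polynomial ℝ) {x : Fin d → ℝ}
    (hx : ∀ k, 0 < xe x k) (y : Fin d → ℝ) {v : Fin d → ℝ} {δ : Fin (d + 1) → ℝ}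
    (hδ : ∀ (s : ℝ) k, xe (x + s • v) k = xe x k + s * δ k) :
    HasDerivAt (fun s : ℝ => ∫ t, p.eval (sqrtForm (x + s • v) y t) ∂arcProd κ)
      (∫ t, p.derivative.eval (sqrtForm x y t) *
        (∑ k, δ k / (2 * √(xe x k)) * √(xe y k) * t k) ∂arcProd κ) 0 := by
  have := isProbabilityMeasure_arcProd hκ
  obtain ⟨ε, hε, hpos⟩ : ∃ ε > 0, ∀ s ∈ Metric.closedBall (0 : ℝ) ε, ∀ k, 0 < xe (x + s • v) k := by
    have h : ∀ᶠ s in nhds (0 : ℝ), ∀ k, 0 < xe (x + s • v) k := by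
      refine Filter.eventually_all.mpr fun k => ?_
      have hc : Continuous fun s : ℝ => xe (x + s • v) k := by fun_prop
      exact hc.continuousAt.eventually_const_lt (by simpa using hx k)
    exact (Metric.nhds_basis_closedBall.eventually_iff).mp h
  set F' : ℝ → (Fin (d + 1) → ℝ) → ℝ := fun s t => p.derivative.eval (sqrtForm (x + s • v) y t) *
    (∑ k, δ k / (2 * √(xe (x + s • v) k)) * √(xe y k) * t k) with hF'
  have hcont : ContinuousOn (fun q : ℝ × (Fin (d + 1) → ℝ) => F' q.1 q.2)
      (Metric.closedBall 0 ε ×ˢ Set.Icc (-1) 1) := by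
    refine ContinuousOn.mul (Continuous.continuousOn ?_) (continuousOn_finsetSum _ fun k _ => ?_)
    · unfold sqrtForm
      fun_prop
    · refine ContinuousOn.mul (ContinuousOn.mul (ContinuousOn.div ?_ ?_ ?_) ?_) ?_
      · fun_prop
      · fun_prop
      · rintro q ⟨hq, -⟩
        have := Real.sqrt_pos.mpr (hpos q.1 hq k)
        positivity
      · fun_prop
      · fun_prop
  obtain ⟨M, hM⟩ := ((isCompact_closedBall (0 : ℝ) ε).prod isCompact_Icc).exists_bound_of_continuousOn
    hcont
  have h := hasDerivAt_integral_of_dominated_loc_of_deriv_le (μ := arcProd κ) (x₀ := (0 : ℝ))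
    (F := fun s t => p.eval (sqrtForm (x + s • v) y t)) (F' := F') (bound := fun _ => M)
    (Metric.closedBall_mem_nhds 0 hε)
    (Filter.Eventually.of_forall fun s => Continuous.aestronglyMeasurable (by fun_prop))
    (integrable_arcProd hκ (by fun_prop))
    (Continuous.aestronglyMeasurable (by simp only [hF']; fun_prop)) ?_ (integrable_const M)
    (Filter.Eventually.of_forall fun t s hs => ?_)
  · simpa [hF'] using h.2
  · filter_upwards [ae_forall_abs_le_one_arcProd hκ] with t ht s hs
    exact hM (s, t) ⟨hs, fun i => (abs_le.mp (ht i)).1, fun i => (abs_le.mp (ht i)).2⟩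
  · refine (p.hasDerivAt _).comp s ?_
    unfold sqrtForm
    refine HasDerivAt.fun_sum fun k _ => ?_
    have h1 : HasDerivAt (fun s : ℝ => xe (x + s • v) k) (δ k) s := by
      simp only [hδ]
      simpa using ((hasDerivAt_id s).mul_const (δ k)).const_add (xe x k)
    exact ((h1.sqrt (hpos s hs k).ne').mul_const _).mul_const _

lemma pdE_sub_pdE_Lk (hκ : ∀ i, 0 ≤ κ i) (hd : 0 < d) {P : ℕ → (Fin d → ℝ) → (Fin d → ℝ) → ℝ}
    (hP : IsRK d κ P) {a : ℝ → ℝ} (ha : IsCutoff a) {n : ℕ} (hn : 0 < n) (i j : Fin (d + 1))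
    {x y : Fin d → ℝ} (hx : x ∈ interior (Splx d)) (hy : y ∈ Splx d) :
    pdE i (fun z => Lk a P n z y) x - pdE j (fun z => Lk a P n z y) x =
      ∫ t, gegSum ((∑ i, κ i) + d + 1) a 0 n (sqrtForm x y t) *
        ((√(xe x j) * √(xe y i) * t i - √(xe x i) * √(xe y j) * t j) /
          √(xe x i * xe x j)) ∂arcProd κ := by
  have hX := xe_pos_of_mem_interior hd hx
  rw [pdE_sub_pdE_eq_fderiv]
  set v : Fin d → ℝ := fun l => diffInd i j l.castSucc with hv
  have hline : HasDerivAt (fun s : ℝ => x + s • v) v 0 := by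
    simpa using ((hasDerivAt_id (0 : ℝ)).smul_const v).const_add x
  have h1 : HasDerivAt (fun s : ℝ => Lk a P n (x + s • v) y)
      (fderiv ℝ (fun z => Lk a P n z y) x v) 0 := by
    have h := (hP.differentiable_Lk ha hn y (x + (0 : ℝ) • v)).hasFDerivAt.comp_hasDerivAt 0 hline
    simpa [Function.comp_def] using h
  have h2 := hasDerivAt_integral_eval_sqrtForm hκ (locPoly ((∑ i, κ i) + d) a n) hX y
    (xe_add_smul_diffInd i j x)
  have h3 : (fun s : ℝ => Lk a P n (x + s • v) y) =ᶠ[nhds 0] fun s =>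
      ∫ t, (locPoly ((∑ i, κ i) + d) a n).eval (sqrtForm (x + s • v) y t) ∂arcProd κ := by
    have hc : Continuous fun s : ℝ => x + s • v := by fun_prop
    have : ∀ᶠ s in nhds (0 : ℝ), x + s • v ∈ interior (Splx d) :=
      hc.continuousAt.eventually_mem (isOpen_interior.mem_nhds (by simpa using hx))
    filter_upwards [this] with s hs
    exact Lk_eq_integral_locPoly hκ hd hP ha hn hs hy
  rw [h1.unique (h2.congr_of_eventuallyEq h3)]
  refine integral_congr_ae (Filter.Eventually.of_forall fun t => ?_)
  have hl : 0 < (∑ i, κ i) + (d : ℝ) :=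
    add_pos_of_nonneg_of_pos (sum_nonneg fun i _ => hκ i) (by exact_mod_cast hd)
  have hsum : ∑ k, diffInd i j k / (2 * √(xe x k)) * √(xe y k) * t k =
      1 / (2 * √(xe x i)) * √(xe y i) * t i - 1 / (2 * √(xe x j)) * √(xe y j) * t j := by
    simp only [diffInd, sub_div, sub_mul, sum_sub_distrib, ite_div, zero_div, ite_mul, zero_mul,
      sum_ite_eq', mem_univ, if_true]
  have hi := Real.sqrt_pos.mpr (hX i)
  have hj := Real.sqrt_pos.mpr (hX j)
  simp only []
  rw [hsum, eval_derivative_locPoly hl, Real.sqrt_mul (hX i).le]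
  field_simp

end Derivative

section Geometry

variable {d : ℕ} {x y : Fin d → ℝ}

lemma dT_eq_arccos (x y : Fin d → ℝ) : dT x y = Real.arccos (sqrtForm x y 1) := by
  simp [dT, sqrtForm, Fin.sum_univ_castSucc]

lemma one_sub_sqrtForm (x y : Fin d → ℝ) (t : Fin (d + 1) → ℝ) :
    1 - sqrtForm x y t =
      (1 - sqrtForm x y 1) + ∑ k, √(xe x k) * √(xe y k) * (1 - t k) := by
  simp only [sqrtForm, mul_sub, sum_sub_distrib, Pi.one_apply]
  ring

lemma two_mul_one_sub_sqrtForm_one (hx : x ∈ Splx d) (hy : y ∈ Splx d) :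
    2 * (1 - sqrtForm x y 1) = ∑ k, (√(xe x k) - √(xe y k)) ^ 2 := by
  have h : ∀ k, (√(xe x k) - √(xe y k)) ^ 2 =
      xe x k + xe y k - 2 * (√(xe x k) * √(xe y k) * 1) := fun k => by
    linear_combination Real.sq_sqrt (mem_Splx_iff.mp hx k) + Real.sq_sqrt (mem_Splx_iff.mp hy k)
  simp only [h, sum_sub_distrib, sum_add_distrib, sum_xe, ← mul_sum]
  simp only [sqrtForm, Pi.one_apply]
  ring

lemma sq_sub_sqrt_le (hx : x ∈ Splx d) (hy : y ∈ Splx d) (k : Fin (d + 1)) :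
    (√(xe x k) - √(xe y k)) ^ 2 ≤ 2 * (1 - sqrtForm x y 1) := by
  rw [two_mul_one_sub_sqrtForm_one hx hy]
  exact single_le_sum (f := fun k => (√(xe x k) - √(xe y k)) ^ 2) (fun _ _ => sq_nonneg _)
    (mem_univ k)

lemma sqrtForm_one_le_one (hx : x ∈ Splx d) (hy : y ∈ Splx d) : sqrtForm x y 1 ≤ 1 := by
  have := (sq_nonneg _).trans (sq_sub_sqrt_le hx hy 0)
  linarith

lemma sqrtForm_one_nonneg (x y : Fin d → ℝ) : 0 ≤ sqrtForm x y 1 :=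
  sum_nonneg fun k _ => by simp only [Pi.one_apply]; positivity

variable {t : Fin (d + 1) → ℝ}

lemma one_sub_sqrtForm_one_le (ht : ∀ k, |t k| ≤ 1) :
    1 - sqrtForm x y 1 ≤ 1 - sqrtForm x y t := by
  rw [one_sub_sqrtForm x y t]
  refine le_add_of_nonneg_right (sum_nonneg fun k _ => ?_)
  have := sub_nonneg.mpr (abs_le.mp (ht k)).2
  positivity

lemma mul_one_sub_le_one_sub_sqrtForm (hx : x ∈ Splx d) (hy : y ∈ Splx d) (ht : ∀ k, |t k| ≤ 1)
    (k : Fin (d + 1)) : √(xe x k) * √(xe y k) * (1 - t k) ≤ 1 - sqrtForm x y t := by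
  rw [one_sub_sqrtForm x y t]
  have h := single_le_sum (f := fun k => √(xe x k) * √(xe y k) * (1 - t k)) (fun k _ => by
    have := sub_nonneg.mpr (abs_le.mp (ht k)).2
    positivity) (mem_univ k)
  have := sqrtForm_one_le_one hx hy
  linarith

lemma abs_sqrtForm_le_one (hx : x ∈ Splx d) (hy : y ∈ Splx d) (ht : ∀ k, |t k| ≤ 1) :
    |sqrtForm x y t| ≤ 1 := by
  refine le_trans ?_ (sqrtForm_one_le_one hx hy)
  refine (abs_sum_le_sum_abs _ _).trans (sum_le_sum fun k _ => ?_)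
  rw [abs_mul, abs_of_nonneg (by positivity)]
  gcongr
  simpa using ht k

lemma abs_sqrt_mul_sub_sqrt_le (hx : x ∈ Splx d) (hy : y ∈ Splx d) (ht : ∀ k, |t k| ≤ 1)
    (k : Fin (d + 1)) :
    |√(xe y k) * t k - √(xe x k)| ≤ 6 * √(1 - sqrtForm x y t) := by
  have hu := one_sub_sqrtForm_one_le (x := x) (y := y) ht
  have h1 := sq_sub_sqrt_le hx hy k
  have h2 := mul_one_sub_le_one_sub_sqrtForm hx hy ht k
  have h0 : 0 ≤ 1 - sqrtForm x y t := by
    have := sqrtForm_one_le_one hx hy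
    linarith
  have hD := Real.sq_sqrt h0
  have hD0 := Real.sqrt_nonneg (1 - sqrtForm x y t)
  set D := √(1 - sqrtForm x y t)
  have hp := Real.sqrt_nonneg (xe x k)
  have hq := Real.sqrt_nonneg (xe y k)
  set p := √(xe x k)
  set q := √(xe y k)
  have ht1 := (abs_le.mp (ht k)).1
  have ht2 := (abs_le.mp (ht k)).2
  rw [← hD] at h2 hu
  have h3 : (p - q) ^ 2 ≤ (3 / 2 * D) ^ 2 := by nlinarith
  have h4 := abs_le.mp (abs_le_of_sq_le_sq h3 (by positivity))
  set z := q * (1 - t k) with hz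
  have hz0 : 0 ≤ z := mul_nonneg hq (by linarith)
  have h5 : z ^ 2 ≤ 2 * D ^ 2 + 3 * (z * D) := by
    have e1 : z ^ 2 ≤ 2 * (q * z) := by
      have : z ≤ 2 * q := by nlinarith
      nlinarith
    have e2 : q * z = p * q * (1 - t k) + z * (q - p) := by ring
    have e3 : z * (q - p) ≤ z * (3 / 2 * D) := by
      gcongr
      linarith
    linarith
  have h6 : z ≤ 4 * D := by
    by_contra! h
    nlinarith
  have h7 : q * t k - p = (q - p) - z := by rw [hz]; ring
  rw [h7, abs_le]
  constructor <;> linarith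

lemma abs_numerator_le (hx : x ∈ Splx d) (hy : y ∈ Splx d) (ht : ∀ k, |t k| ≤ 1)
    (i j : Fin (d + 1)) :
    |√(xe x j) * √(xe y i) * t i - √(xe x i) * √(xe y j) * t j| ≤
      12 * √(xe x i + xe x j) * √(1 - sqrtForm x y t) := by
  have hi := abs_sqrt_mul_sub_sqrt_le hx hy ht i
  have hj := abs_sqrt_mul_sub_sqrt_le hx hy ht j
  have hXi := mem_Splx_iff.mp hx i
  have hXj := mem_Splx_iff.mp hx j
  have h1 : √(xe x i) ≤ √(xe x i + xe x j) := Real.sqrt_le_sqrt (by linarith)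
  have h2 : √(xe x j) ≤ √(xe x i + xe x j) := Real.sqrt_le_sqrt (by linarith)
  calc _ = |√(xe x j) * (√(xe y i) * t i - √(xe x i)) -
        √(xe x i) * (√(xe y j) * t j - √(xe x j))| := by ring_nf
    _ ≤ √(xe x j) * |√(xe y i) * t i - √(xe x i)| +
        √(xe x i) * |√(xe y j) * t j - √(xe x j)| := by
      refine (abs_sub _ _).trans_eq ?_
      rw [abs_mul, abs_mul, abs_of_nonneg (Real.sqrt_nonneg _), abs_of_nonneg (Real.sqrt_nonneg _)]
    _ ≤ √(xe x i + xe x j) * (6 * √(1 - sqrtForm x y t)) +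
        √(xe x i + xe x j) * (6 * √(1 - sqrtForm x y t)) := by gcongr
    _ = _ := by ring

lemma one_add_mul_dT_sq_le (hx : x ∈ Splx d) (hy : y ∈ Splx d) (r : ℝ) :
    (1 + r * dT x y) ^ 2 ≤ 10 * (1 + r ^ 2 * (1 - sqrtForm x y 1)) := by
  rw [dT_eq_arccos]
  have h0 := Real.arccos_nonneg (sqrtForm x y 1)
  have hc := Real.cos_arccos (by linarith [sqrtForm_one_nonneg x y]) (sqrtForm_one_le_one hx hy)
  have h1 := one_add_mul_one_sub_cos_ge (B := 1) zero_le_one h0 (Real.arccos_le_pi _)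
  have h2 := Real.cos_le_one_sub_mul_cos_sq
    (by rw [abs_of_nonneg h0]; exact Real.arccos_le_pi _ : |Real.arccos (sqrtForm x y 1)| ≤ Real.pi)
  rw [hc] at h2
  set s := Real.arccos (sqrtForm x y 1)
  have hpi : Real.pi ^ 2 ≤ 10 := by nlinarith [Real.pi_lt_d2, Real.pi_pos]
  have h3 : 2 / 10 * s ^ 2 ≤ 2 / Real.pi ^ 2 * s ^ 2 := by gcongr
  have h4 : r ^ 2 * (2 / 10 * s ^ 2) ≤ r ^ 2 * (1 - sqrtForm x y 1) := by
    gcongr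
    linarith
  nlinarith [sq_nonneg (r * s - 1)]

lemma one_add_mul_xe_mul_le (hx : x ∈ Splx d) (hy : y ∈ Splx d) (r : ℝ) (k : Fin (d + 1)) :
    (1 + r ^ 2 * xe x k) * (1 + r ^ 2 * xe y k) ≤
      2 * (1 + r ^ 2 * (√(xe x k) * √(xe y k))) ^ 2 * (1 + r ^ 2 * (1 - sqrtForm x y 1)) := by
  have h1 := sq_sub_sqrt_le hx hy k
  have hX := Real.sq_sqrt (mem_Splx_iff.mp hx k)
  have hY := Real.sq_sqrt (mem_Splx_iff.mp hy k)
  have hp := Real.sqrt_nonneg (xe x k)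
  have hq := Real.sqrt_nonneg (xe y k)
  set p := √(xe x k)
  set q := √(xe y k)
  rw [← hX, ← hY]
  have h2 : r ^ 2 * (p - q) ^ 2 ≤ 2 * (r ^ 2 * (1 - sqrtForm x y 1)) := by
    rw [mul_left_comm]
    gcongr
  have h3 : 0 ≤ r ^ 2 * (1 - sqrtForm x y 1) :=
    mul_nonneg (sq_nonneg r) (by linarith [sqrtForm_one_le_one hx hy])
  have h4 : 1 ≤ (1 + r ^ 2 * (p * q)) ^ 2 := one_le_pow₀ (le_add_of_nonneg_right (by positivity))
  nlinarith [mul_nonneg (sub_nonneg.mpr h4) h3]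

end Geometry

section Assembly

variable {d : ℕ} {κ : Fin (d + 1) → ℝ}

lemma exists_abs_gegSum_mul_sqrt_le {a : ℝ → ℝ} (ha : IsCutoff a) {μ : ℝ} (hμ : 2 ≤ μ)
    {E : ℝ} (hE : 0 ≤ E) {c : Fin (d + 1) → ℝ} (hc : ∀ k, 0 ≤ c k) :
    ∃ C, 0 ≤ C ∧ ∀ n : ℕ, 0 < n → ∀ u : ℝ, |u| ≤ 1 → ∀ (Q : ℝ) (T : Fin (d + 1) → ℝ), 1 ≤ Q →
      Q ≤ 1 + (n : ℝ) ^ 2 * (1 - u) → (∀ k, 1 ≤ T k) → (∀ k, T k ≤ 1 + (n : ℝ) ^ 2 * (1 - u)) →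
      |gegSum μ a 0 n u| * √(1 - u) ≤ C * (n : ℝ) ^ (2 * μ) * Q ^ (-E) * ∏ k, T k ^ (-c k) := by
  obtain ⟨C, hC, h⟩ := exists_abs_gegSum_mul_one_add_pow_le ha hμ (⌈E + ∑ k, c k⌉₊ + 1)
  refine ⟨C, hC, fun n hn u hu Q T hQ hQR hT hTR => ?_⟩
  have h := h n hn u hu
  have hn' : (0 : ℝ) < n := by exact_mod_cast hn
  have hu1 : 0 ≤ 1 - u := by linarith [(abs_le.mp hu).2]
  set R := 1 + (n : ℝ) ^ 2 * (1 - u) with hR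
  have hR1 : 1 ≤ R := hQ.trans hQR
  have hR0 : 0 < R := by linarith
  have hD : n * √(1 - u) ≤ R := by
    have := Real.sq_sqrt hu1
    nlinarith [sq_nonneg (n * √(1 - u) - 1)]
  have hpow : Q ^ E * ∏ k, T k ^ c k ≤ R ^ ⌈E + ∑ k, c k⌉₊ := by
    calc Q ^ E * ∏ k, T k ^ c k ≤ R ^ E * ∏ k, R ^ c k := by
          refine mul_le_mul (Real.rpow_le_rpow (by linarith) hQR hE) (prod_le_prod ?_ ?_) ?_ ?_
          · exact fun k _ => Real.rpow_nonneg (by linarith [hT k]) _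
          · exact fun k _ => Real.rpow_le_rpow (by linarith [hT k]) (hTR k) (hc k)
          · exact prod_nonneg fun k _ => Real.rpow_nonneg (by linarith [hT k]) _
          · positivity
      _ = R ^ (E + ∑ k, c k) := by
          rw [Real.rpow_add hR0, Real.rpow_sum_of_pos hR0]
      _ ≤ R ^ (⌈E + ∑ k, c k⌉₊ : ℝ) := Real.rpow_le_rpow_of_exponent_le hR1 (Nat.le_ceil _)
      _ = _ := Real.rpow_natCast _ _
  have hQE : 0 < Q ^ E := Real.rpow_pos_of_pos (by linarith) _
  have hTc : 0 < ∏ k, T k ^ c k := prod_pos fun k _ => Real.rpow_pos_of_pos (by linarith [hT k]) _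
  have e1 : Q ^ (-E) * ∏ k, T k ^ (-c k) = (Q ^ E * ∏ k, T k ^ c k)⁻¹ := by
    rw [mul_inv, Real.rpow_neg (by linarith), ← prod_inv_distrib]
    congr 1
    exact prod_congr rfl fun k _ => Real.rpow_neg (by linarith [hT k]) _
  rw [mul_assoc, e1, ← div_eq_mul_inv, le_div_iff₀ (by positivity)]
  have h2 : |gegSum μ a 0 n u| * (n * √(1 - u)) * (Q ^ E * ∏ k, T k ^ c k) ≤
      C * (n : ℝ) ^ (2 * μ + 1) := by
    calc _ ≤ |gegSum μ a 0 n u| * R * R ^ ⌈E + ∑ k, c k⌉₊ := by gcongr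
      _ = |gegSum μ a 0 n u| * R ^ (⌈E + ∑ k, c k⌉₊ + 1) := by ring
      _ ≤ _ := h
  rw [Real.rpow_add_one hn'.ne'] at h2
  refine le_of_mul_le_mul_right ?_ hn'
  linarith

/-- The quantity `1 + r² (1 - cos d_△(x, y))`. -/
def distFactor (r : ℝ) (x y : Fin d → ℝ) : ℝ := 1 + r ^ 2 * (1 - sqrtForm x y 1)

/-- The quantity `1 + r² √(x_k y_k)`. -/
def diagFactor (r : ℝ) (x y : Fin d → ℝ) (k : Fin (d + 1)) : ℝ :=
  1 + r ^ 2 * (√(xe x k) * √(xe y k))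

lemma one_le_distFactor {x y : Fin d → ℝ} (hx : x ∈ Splx d) (hy : y ∈ Splx d) (r : ℝ) :
    1 ≤ distFactor r x y :=
  le_add_of_nonneg_right (mul_nonneg (sq_nonneg r) (by linarith [sqrtForm_one_le_one hx hy]))

lemma one_le_diagFactor (x y : Fin d → ℝ) (r : ℝ) (k : Fin (d + 1)) : 1 ≤ diagFactor r x y k :=
  le_add_of_nonneg_right (by positivity)

lemma exists_abs_pdE_sub_pdE_Lk_le (hκ : ∀ i, 0 ≤ κ i) (hd : 2 ≤ d)
    {P : ℕ → (Fin d → ℝ) → (Fin d → ℝ) → ℝ} (hP : IsRK d κ P) {a : ℝ → ℝ} (ha : IsCutoff a)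
    {E : ℝ} (hE : 0 ≤ E) :
    ∃ C, 0 ≤ C ∧ ∀ n : ℕ, 0 < n → ∀ i j : Fin (d + 1),
      ∀ x ∈ interior (Splx d), ∀ y ∈ Splx d,
        |pdE i (fun z => Lk a P n z y) x - pdE j (fun z => Lk a P n z y) x| ≤
          C * (n : ℝ) ^ (2 * ((∑ k, κ k) + d + 1)) *
            (√(xe x i + xe x j) / √(xe x i * xe x j)) * distFactor n x y ^ (-E) *
              ∏ k, diagFactor n x y k ^ (-(κ k + 1 / 2)) := by
  have hd2 : (2 : ℝ) ≤ d := by exact_mod_cast hd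
  have hμ : 2 ≤ (∑ k, κ k) + (d : ℝ) + 1 := by
    linarith [sum_nonneg fun k (_ : k ∈ univ) => hκ k]
  obtain ⟨C, hC, hS⟩ := exists_abs_gegSum_mul_sqrt_le ha hμ hE
    (c := fun k => κ k + 1) fun k => by linarith [hκ k]
  choose B hB hT using fun k => exists_integral_arcMeasure_tail_le (hκ k)
  refine ⟨12 * C * ∏ k, B k, mul_nonneg (by positivity) (prod_nonneg fun k _ => hB k),
    fun n hn i j x hx y hy => ?_⟩
  have hn' : (0 : ℝ) < n := by exact_mod_cast hn
  have hx' := interior_subset hx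
  rw [pdE_sub_pdE_Lk hκ (by omega) hP ha hn i j hx hy]
  set A := 12 * C * (n : ℝ) ^ (2 * ((∑ k, κ k) + d + 1)) *
    (√(xe x i + xe x j) / √(xe x i * xe x j)) * distFactor n x y ^ (-E) with hA
  have hA0 : 0 ≤ A := by
    have := one_le_distFactor hx' hy n
    positivity
  set b : Fin (d + 1) → ℝ := fun k => (n : ℝ) ^ 2 * (√(xe x k) * √(xe y k)) with hb
  have hb0 : ∀ k, 0 ≤ b k := fun k => by simp only [hb]; positivity
  have hcont : Continuous fun t : Fin (d + 1) → ℝ => ∏ k, (1 + b k * |1 - t k|) ^ (-(κ k + 1)) :=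
    continuous_finsetProd _ fun k _ => Continuous.rpow_const (by fun_prop) fun t => by
      have := mul_nonneg (hb0 k) (abs_nonneg (1 - t k))
      exact Or.inl (by linarith)
  have hbound : ∀ᵐ t ∂arcProd κ, ‖gegSum ((∑ i, κ i) + d + 1) a 0 n (sqrtForm x y t) *
        ((√(xe x j) * √(xe y i) * t i - √(xe x i) * √(xe y j) * t j) / √(xe x i * xe x j))‖ ≤
      A * ∏ k, (1 + b k * |1 - t k|) ^ (-(κ k + 1)) := by
    filter_upwards [ae_forall_abs_le_one_arcProd hκ] with t ht
    have habs : ∀ k, |1 - t k| = 1 - t k := fun k =>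
      abs_of_nonneg (by linarith [(abs_le.mp (ht k)).2])
    have h1 := hS n hn _ (abs_sqrtForm_le_one hx' hy ht) (distFactor n x y)
      (fun k => 1 + b k * |1 - t k|) (one_le_distFactor hx' hy n)
      (by unfold distFactor; gcongr; linarith [one_sub_sqrtForm_one_le (x := x) (y := y) ht])
      (fun k => le_add_of_nonneg_right (mul_nonneg (hb0 k) (abs_nonneg _)))
      (fun k => by
        rw [habs, hb]
        simp only [mul_assoc ((n : ℝ) ^ 2)]
        gcongr
        exact mul_one_sub_le_one_sub_sqrtForm hx' hy ht k)
    have h2 := abs_numerator_le hx' hy ht i j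
    rw [Real.norm_eq_abs, abs_mul, abs_div, abs_of_nonneg (Real.sqrt_nonneg (xe x i * xe x j))]
    calc _ ≤ |gegSum ((∑ i, κ i) + d + 1) a 0 n (sqrtForm x y t)| *
          (12 * √(xe x i + xe x j) * √(1 - sqrtForm x y t) / √(xe x i * xe x j)) := by gcongr
      _ = |gegSum ((∑ i, κ i) + d + 1) a 0 n (sqrtForm x y t)| * √(1 - sqrtForm x y t) *
          (12 * (√(xe x i + xe x j) / √(xe x i * xe x j))) := by ring
      _ ≤ C * (n : ℝ) ^ (2 * ((∑ k, κ k) + d + 1)) * distFactor n x y ^ (-E) *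
          (∏ k, (1 + b k * |1 - t k|) ^ (-(κ k + 1))) *
          (12 * (√(xe x i + xe x j) / √(xe x i * xe x j))) :=
        mul_le_mul_of_nonneg_right h1 (by positivity)
      _ = _ := by rw [hA]; ring
  refine (norm_integral_le_of_norm_le ((integrable_arcProd hκ hcont).const_mul A) hbound).trans ?_
  rw [integral_const_mul, integral_arcProd_prod hκ fun k s => (1 + b k * |1 - s|) ^ (-(κ k + 1))]
  calc _ ≤ A * ∏ k, (B k * diagFactor n x y k ^ (-(κ k + 1 / 2))) := by
        refine mul_le_mul_of_nonneg_left (prod_le_prod (fun k _ => ?_) fun k _ => ?_) hA0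
        · refine integral_nonneg fun s => Real.rpow_nonneg ?_ _
          have := mul_nonneg (hb0 k) (abs_nonneg (1 - s))
          linarith
        · exact hT k (b k) (hb0 k)
    _ = _ := by rw [prod_mul_distrib, hA]; ring

lemma sqrt_Wkn_mul_sqrt_Wkn_le (hκ : ∀ i, 0 ≤ κ i) {x y : Fin d → ℝ} (hx : x ∈ Splx d)
    (hy : y ∈ Splx d) {n : ℕ} (hn : 0 < n) :
    √(Wkn κ n x) * √(Wkn κ n y) ≤
      2 ^ ((∑ k, (κ k + 1 / 2)) / 2) * (n : ℝ) ^ (-(2 * ∑ k, (κ k + 1 / 2))) *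
        (∏ k, diagFactor n x y k ^ (κ k + 1 / 2)) *
          distFactor n x y ^ ((∑ k, (κ k + 1 / 2)) / 2) := by
  have hn' : (0 : ℝ) < n := by exact_mod_cast hn
  have hQ := one_le_distFactor hx hy n
  have hQ0 : 0 < distFactor n x y := by linarith
  have hX := mem_Splx_iff.mp hx
  have hY := mem_Splx_iff.mp hy
  have key : ∀ k, ((xe x k + 1 / (n : ℝ) ^ 2) ^ (κ k + 1 / 2) *
      (xe y k + 1 / (n : ℝ) ^ 2) ^ (κ k + 1 / 2)) ≤
      (2 ^ ((κ k + 1 / 2) / 2) * (n : ℝ) ^ (-(2 * (κ k + 1 / 2))) *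
        diagFactor n x y k ^ (κ k + 1 / 2) * distFactor n x y ^ ((κ k + 1 / 2) / 2)) ^ 2 := by
    intro k
    have hk : 0 ≤ κ k + 1 / 2 := by linarith [hκ k]
    have hX := hX k
    have hY := hY k
    have hG : 0 < diagFactor n x y k := by linarith [one_le_diagFactor x y n k]
    have h1 := one_add_mul_xe_mul_le hx hy n k
    have h2 : (xe x k + 1 / (n : ℝ) ^ 2) * (xe y k + 1 / (n : ℝ) ^ 2) ≤
        2 * ((n : ℝ) ^ 4)⁻¹ * diagFactor n x y k ^ 2 * distFactor n x y := by
      have e : (xe x k + 1 / (n : ℝ) ^ 2) * (xe y k + 1 / (n : ℝ) ^ 2) =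
          ((n : ℝ) ^ 4)⁻¹ * ((1 + (n : ℝ) ^ 2 * xe x k) * (1 + (n : ℝ) ^ 2 * xe y k)) := by
        field_simp
        ring
      rw [e, mul_comm (2 : ℝ), mul_assoc, mul_assoc, ← mul_assoc (2 : ℝ)]
      exact mul_le_mul_of_nonneg_left h1 (by positivity)
    rw [← Real.mul_rpow (by positivity) (by positivity)]
    refine (Real.rpow_le_rpow (by positivity) h2 hk).trans_eq ?_
    have hsq : ∀ z : ℝ, 0 < z → ∀ e : ℝ, (z ^ e) ^ 2 = z ^ (2 * e) := fun z hz e => by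
      rw [← Real.rpow_natCast, ← Real.rpow_mul hz.le, mul_comm]
      norm_num
    rw [Real.mul_rpow (by positivity) hQ0.le, Real.mul_rpow (by positivity) (by positivity),
      Real.mul_rpow (by positivity) (by positivity), mul_pow, mul_pow, mul_pow,
      hsq 2 two_pos, hsq _ hn', hsq _ hQ0, hsq _ hG, Real.inv_rpow (by positivity),
      ← Real.rpow_neg (by positivity), ← Real.rpow_natCast (n : ℝ), ← Real.rpow_mul hn'.le,
      ← Real.rpow_natCast (diagFactor n x y k), ← Real.rpow_mul hG.le]
    push_cast
    congr 1
    · congr 1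
      congr 1
      · congr 1; ring
      · congr 1; ring
    · congr 1; ring
  have hprod : (2 : ℝ) ^ ((∑ k, (κ k + 1 / 2)) / 2) * (n : ℝ) ^ (-(2 * ∑ k, (κ k + 1 / 2))) *
        (∏ k, diagFactor n x y k ^ (κ k + 1 / 2)) *
          distFactor n x y ^ ((∑ k, (κ k + 1 / 2)) / 2) =
      ∏ k, (2 ^ ((κ k + 1 / 2) / 2) * (n : ℝ) ^ (-(2 * (κ k + 1 / 2))) *
        diagFactor n x y k ^ (κ k + 1 / 2) * distFactor n x y ^ ((κ k + 1 / 2) / 2)) := by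
    rw [prod_mul_distrib, prod_mul_distrib, prod_mul_distrib, ← Real.rpow_sum_of_pos two_pos,
      ← Real.rpow_sum_of_pos hn', ← Real.rpow_sum_of_pos hQ0, ← sum_div, sum_neg_distrib, ← mul_sum]
  have hW : 0 ≤ Wkn κ n x := prod_nonneg fun k _ => by
    have := hX k
    positivity
  rw [← Real.sqrt_mul hW, hprod]
  refine Real.sqrt_le_iff.mpr ⟨prod_nonneg fun k _ => ?_, ?_⟩
  · have hG : 0 < diagFactor n x y k := by linarith [one_le_diagFactor x y n k]
    positivity
  · rw [Wkn, Wkn, ← prod_mul_distrib, ← prod_pow]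
    refine prod_le_prod (fun k _ => ?_) fun k _ => key k
    have := hX k
    have := hY k
    positivity

lemma one_add_mul_dT_rpow_le {x y : Fin d → ℝ} (hx : x ∈ Splx d) (hy : y ∈ Splx d) {r : ℝ}
    (hr : 0 ≤ r) {s : ℝ} (hs : 0 ≤ s) :
    (1 + r * dT x y) ^ s ≤ 10 ^ (s / 2) * distFactor r x y ^ (s / 2) := by
  have h0 : 0 ≤ dT x y := by rw [dT_eq_arccos]; exact Real.arccos_nonneg _
  have hQ := one_le_distFactor hx hy r
  rw [← Real.mul_rpow (by norm_num) (by linarith)]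
  calc (1 + r * dT x y) ^ s = ((1 + r * dT x y) ^ 2) ^ (s / 2) := by
        rw [← Real.rpow_natCast, ← Real.rpow_mul (by positivity)]
        congr 1
        push_cast
        ring
    _ ≤ _ := Real.rpow_le_rpow (by positivity) (one_add_mul_dT_sq_le hx hy r) (by positivity)

end Assembly

/-- the estimate for the derivatives `∂_{i,j} L_n^κ` (Proposition 3.6). -/
theorem stmt18 (d : ℕ) (hd : 2 ≤ d) (κ : Fin (d+1) → ℝ) (hκ : ∀ i, 0 ≤ κ i)
    (P : ℕ → (Fin d → ℝ) → (Fin d → ℝ) → ℝ) (hP : IsRK d κ P)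
    (a : ℝ → ℝ) (ha : IsCutoff a)
    (γ : ℝ) (hγ : 2 * (∑ k, κ k) + 2 ≤ γ) :
    ∃ c > 0, ∀ n : ℕ, 0 < n → ∀ i j : Fin (d+1), i < j →
      ∀ x ∈ interior (Splx d), ∀ y ∈ interior (Splx d),
        |pdE i (fun z => Lk a P n z y) x - pdE j (fun z => Lk a P n z y) x| ≤
          c * (n : ℝ) ^ (d + 1) * (Real.sqrt (xe x i + xe x j) + 1 / (n : ℝ)) /
            (Real.sqrt (xe x i * xe x j) * Real.sqrt (Wkn κ n x) * Real.sqrt (Wkn κ n y) *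
              (1 + (n : ℝ) * dT x y) ^ (γ - 2 * (∑ k, κ k) - 2)) := by
  have hd2 : (2 : ℝ) ≤ d := by exact_mod_cast hd
  have hκ0 : 0 ≤ ∑ k, κ k := sum_nonneg fun k _ => hκ k
  set σ := γ - 2 * (∑ k, κ k) - 2 with hσ
  have hσ0 : 0 ≤ σ := by linarith
  set s := ∑ k, (κ k + 1 / 2) with hs
  have hs' : s = (∑ k, κ k) + ((d : ℝ) + 1) / 2 := by
    rw [hs, sum_add_distrib]
    simp
    ring
  have hs0 : 0 ≤ s := by rw [hs']; positivity
  obtain ⟨C, hC, h⟩ := exists_abs_pdE_sub_pdE_Lk_le hκ hd hP ha (E := σ / 2 + s / 2)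
    (by positivity)
  refine ⟨C * 2 ^ (s / 2) * 10 ^ (σ / 2) + 1, by positivity, fun n hn i j _ x hx y hy => ?_⟩
  have hn' : (0 : ℝ) < n := by exact_mod_cast hn
  have hx' := interior_subset hx
  have hy' := interior_subset hy
  have hX := xe_pos_of_mem_interior (by omega) hx
  have hY := xe_pos_of_mem_interior (by omega) hy
  have hXX : 0 < √(xe x i * xe x j) := Real.sqrt_pos.mpr (mul_pos (hX i) (hX j))
  have hWx : 0 < √(Wkn κ n x) := Real.sqrt_pos.mpr <| prod_pos fun k _ => by
    have := hX k
    positivity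
  have hWy : 0 < √(Wkn κ n y) := Real.sqrt_pos.mpr <| prod_pos fun k _ => by
    have := hY k
    positivity
  have hD : 0 ≤ dT x y := by rw [dT_eq_arccos]; exact Real.arccos_nonneg _
  have hDσ : 0 < (1 + (n : ℝ) * dT x y) ^ σ := by positivity
  have hQ : 0 < distFactor n x y := by linarith [one_le_distFactor hx' hy' n]
  have hG : ∀ k, 0 < diagFactor n x y k := fun k => by linarith [one_le_diagFactor x y n k]
  have hG1 : (∏ k, diagFactor n x y k ^ (-(κ k + 1 / 2))) *
      ∏ k, diagFactor n x y k ^ (κ k + 1 / 2) = 1 := by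
    rw [← prod_mul_distrib]
    exact prod_eq_one fun k _ => by rw [← Real.rpow_add (hG k)]; simp
  have hQ1 : distFactor n x y ^ (-(σ / 2 + s / 2)) *
      (distFactor n x y ^ (s / 2) * distFactor n x y ^ (σ / 2)) = 1 := by
    rw [← Real.rpow_add hQ, ← Real.rpow_add hQ, ← Real.rpow_zero (distFactor n x y)]
    congr 1
    ring
  have hn1 : (n : ℝ) ^ (2 * ((∑ k, κ k) + d + 1)) * (n : ℝ) ^ (-(2 * s)) = (n : ℝ) ^ (d + 1) := by
    rw [← Real.rpow_add hn', ← Real.rpow_natCast, hs']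
    congr 1
    push_cast
    ring
  have hGm : 0 ≤ ∏ k, diagFactor n x y k ^ (-(κ k + 1 / 2)) :=
    prod_nonneg fun k _ => Real.rpow_nonneg (hG k).le _
  have hGp : 0 ≤ ∏ k, diagFactor n x y k ^ (κ k + 1 / 2) :=
    prod_nonneg fun k _ => Real.rpow_nonneg (hG k).le _
  have hS : 0 ≤ √(xe x i + xe x j) := Real.sqrt_nonneg _
  rw [le_div_iff₀ (by positivity)]
  calc _ ≤ C * (n : ℝ) ^ (2 * ((∑ k, κ k) + d + 1)) *
            (√(xe x i + xe x j) / √(xe x i * xe x j)) * distFactor n x y ^ (-(σ / 2 + s / 2)) *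
              (∏ k, diagFactor n x y k ^ (-(κ k + 1 / 2))) *
          (√(xe x i * xe x j) * (2 ^ (s / 2) * (n : ℝ) ^ (-(2 * s)) *
            (∏ k, diagFactor n x y k ^ (κ k + 1 / 2)) * distFactor n x y ^ (s / 2)) *
            (10 ^ (σ / 2) * distFactor n x y ^ (σ / 2))) := by
        refine mul_le_mul (h n hn i j x hx y hy') ?_ (by positivity) (by positivity)
        rw [mul_assoc √(xe x i * xe x j)]
        exact mul_le_mul (mul_le_mul_of_nonneg_left (sqrt_Wkn_mul_sqrt_Wkn_le hκ hx' hy' hn) hXX.le)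
          (one_add_mul_dT_rpow_le hx' hy' hn'.le hσ0) hDσ.le (by positivity)
    _ = C * 2 ^ (s / 2) * 10 ^ (σ / 2) *
          ((n : ℝ) ^ (2 * ((∑ k, κ k) + d + 1)) * (n : ℝ) ^ (-(2 * s))) *
          (√(xe x i + xe x j) / √(xe x i * xe x j) * √(xe x i * xe x j)) *
          ((∏ k, diagFactor n x y k ^ (-(κ k + 1 / 2))) *
            ∏ k, diagFactor n x y k ^ (κ k + 1 / 2)) *
          (distFactor n x y ^ (-(σ / 2 + s / 2)) *
            (distFactor n x y ^ (s / 2) * distFactor n x y ^ (σ / 2))) := by ring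
    _ = C * 2 ^ (s / 2) * 10 ^ (σ / 2) * (n : ℝ) ^ (d + 1) * √(xe x i + xe x j) := by
        rw [hn1, hG1, hQ1, div_mul_cancel₀ _ hXX.ne', mul_one, mul_one]
    _ ≤ _ := by
        gcongr
        · linarith
        · exact le_add_of_nonneg_right (by positivity)
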